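/- Let 𝒱 = {φ_Λ}_{Λ∈𝒞} be a positive, continuous, T-invariant specification on X = S^ℤ with specification sequence {([0,n], f_n)}_{n≥0}. If ∑_{k=0}^∞ ∏_{j=0}^k inf_{i≥0} r̄_{(-∞,i+j]}(f_i) = ∞, then g_𝒱(x) = lim_{n→∞} π^𝒱_{[0,n]}([x]_{{0}} | x) exists for every x, the convergence is uniform in x, g_𝒱 is a strictly positive continuous member of 𝒢_X, r_{[-n,0]}(g_𝒱) ≤ (1 + R_n⁻¹)² for every n ≥ 0 where R_n = ∑_{k=0}^∞ ∏_{j=0}^k inf_{i≥0} r̄_{[-n,i+j]}(f_i), and a probability measure μ is a Gibbs state for 𝒱 if and only if μ is a g_𝒱-chain. -/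

import Mathlib

open MeasureTheory Filter Set Asymptotics

noncomputable section

namespace GibbsFormal

/-- The configuration space `X = S^ℤ`. -/
abbrev Conf (S : Type) := ℤ → S

variable {S : Type} [Fintype S] [Nonempty S] [DecidableEq S]
  [TopologicalSpace S] [DiscreteTopology S]
  [MeasurableSpace S] [MeasurableSingletonClass S]

/-- The configuration obtained from `x` by replacing its coordinates on `Λ` by `ζ`. -/
def ov (x : Conf S) (Λ : Finset ℤ) (ζ : Λ → S) : Conf S :=
  fun i => if h : i ∈ Λ then ζ ⟨i, h⟩ else x i

/-- The configuration `x'_Λ x_{Λᶜ}`, agreeing with `x'` on `Λ` and with `x` off `Λ`. -/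
def merge (Λ : Finset ℤ) (x' x : Conf S) : Conf S :=
  fun i => if i ∈ Λ then x' i else x i

/-- The configuration `s_n x`. -/
def upd (s : S) (n : ℤ) (x : Conf S) : Conf S :=
  fun i => if i = n then s else x i

/-- The shift `Tⁿ`:  `(Tⁿ x) i = x (i + n)`. -/
def shift (n : ℤ) (x : Conf S) : Conf S := fun i => x (i + n)

/-- The sub-σ-algebra `ℬ_Λ` of the Borel (= product) σ-algebra, generated by
coordinates in `Λ`. -/
def cylSA (Λ : Set ℤ) : MeasurableSpace (Conf S) :=
  MeasurableSpace.comap (fun x => Λ.restrict x) inferInstance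

/-- The cylinder set `[ζ]_Λ`. -/
def cylEvent (Λ : Finset ℤ) (ζ : Λ → S) : Set (Conf S) :=
  {y | ∀ i : Λ, y i = ζ i}

/-- `r_Λ(f) = sup {f x / f y : x_Λ = y_Λ}`. -/
def rSup (Λ : Set ℤ) (f : Conf S → ℝ) : ℝ :=
  sSup {r : ℝ | ∃ x y : Conf S, (∀ i ∈ Λ, x i = y i) ∧ f x / f y = r}

/-- `r̄_Λ(f) = inf {f x / f y : x_Λ = y_Λ}`. -/
def rInf (Λ : Set ℤ) (f : Conf S → ℝ) : ℝ :=
  sInf {r : ℝ | ∃ x y : Conf S, (∀ i ∈ Λ, x i = y i) ∧ f x / f y = r}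

/-- A specification `𝒱 = {φ_Λ}` on `S^ℤ`:  a family of nonnegative Borel functions
satisfying the normalisation and consistency conditions.  (The value on the empty set
is normalised to `1`, which is forced by the unguarded normalisation condition.) -/
structure Specification (A : Type) [Fintype A] [MeasurableSpace A] where
  φ : Finset ℤ → Conf A → ℝ
  nonneg : ∀ Λ x, 0 ≤ φ Λ x
  measurable : ∀ Λ, Measurable (φ Λ)
  sum_one : ∀ (Λ : Finset ℤ) (x : Conf A), ∑ ζ : Λ → A, φ Λ (ov x Λ ζ) = 1
  consistent : ∀ (K Λ : Finset ℤ), K ⊆ Λ → ∀ x : Conf A,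
    φ Λ x = φ K x * ∑ ζ : K → A, φ Λ (ov x K ζ)

/-- A positive specification. -/
def Specification.Positive (V : Specification S) : Prop := ∀ Λ x, 0 < V.φ Λ x

/-- A continuous specification. -/
def Specification.IsCont (V : Specification S) : Prop := ∀ Λ, Continuous (V.φ Λ)

/-- A `T`-invariant specification: `φ_{n+Λ}(x) = φ_Λ(Tⁿ x)`. -/
def Specification.TInvariant (V : Specification S) : Prop :=
  ∀ (n : ℤ) (Λ : Finset ℤ) (x : Conf S),
    V.φ (Λ.image fun i => n + i) x = V.φ Λ (shift n x)

/-- The DLR (Gibbs) condition for a family `φfam` of conditional probabilities: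
for each finite nonempty `Λ` and each pattern `ζ` on `Λ`, the conditional probability
of the cylinder `[ζ]_Λ` given `ℬ_{Λᶜ}` is `x ↦ φfam Λ (ζ x_{Λᶜ})`, `μ`-a.e. -/
def GibbsCond (φfam : Finset ℤ → Conf S → ℝ) (μ : Measure (Conf S)) : Prop :=
  ∀ (Λ : Finset ℤ), Λ.Nonempty → ∀ ζ : Λ → S,
    (fun x => φfam Λ (ov x Λ ζ)) =ᵐ[μ]
      μ[(cylEvent Λ ζ).indicator (fun _ => (1 : ℝ)) | cylSA ((↑Λ : Set ℤ)ᶜ)]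

/-- `μ` is a Gibbs state for the specification `V`. -/
def IsGibbs (V : Specification S) (μ : Measure (Conf S)) : Prop :=
  IsProbabilityMeasure μ ∧ GibbsCond V.φ μ

/-- `g ∈ 𝒢_X`: a nonnegative bounded `ℬ_{ℤ⁻}`-measurable function with
`∑_{s ∈ S} g (s_0 x) = 1`. -/
def MemG (g : Conf S → ℝ) : Prop :=
  (∃ C, ∀ x, |g x| ≤ C) ∧ (∀ x, 0 ≤ g x) ∧
    Measurable[cylSA (Set.Iic (0 : ℤ))] g ∧
    ∀ x : Conf S, ∑ s : S, g (upd s 0 x) = 1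

/-- `μ` is a `g`-chain: for every `n` the conditional probability of the symbol at
site `n` given `ℬ_{(-∞,n-1]}` is `x ↦ g (Tⁿ (s_n x))`, `μ`-a.e. -/
def IsGChain (g : Conf S → ℝ) (μ : Measure (Conf S)) : Prop :=
  IsProbabilityMeasure μ ∧ ∀ (n : ℤ) (s : S),
    (fun x => g (shift n (upd s n x))) =ᵐ[μ]
      μ[({y : Conf S | y n = s}).indicator (fun _ => (1 : ℝ)) | cylSA (Set.Iic (n - 1))]

/-- The probability `π^𝒱_{[0,n]}([x]_{{0}} | x)`. -/
def piG (V : Specification S) (n : ℕ) (x : Conf S) : ℝ :=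
  ∑ ζ : (Finset.Icc (0 : ℤ) (n : ℤ)) → S,
    V.φ (Finset.Icc (0 : ℤ) (n : ℤ)) (ov x (Finset.Icc (0 : ℤ) (n : ℤ)) ζ) *
      (if ov x (Finset.Icc (0 : ℤ) (n : ℤ)) ζ 0 = x 0 then 1 else 0)

/-- A specification sequence of the form `{([0,n], f_n)}`: each `f_n` is bounded,
strictly positive and `ℬ_{[0,n-1]ᶜ}`-measurable. -/
def IsSpecSeq (f : ℕ → Conf S → ℝ) : Prop :=
  ∀ n : ℕ, (∃ C, ∀ x, f n x ≤ C) ∧ (∀ x, 0 < f n x) ∧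
    Measurable[cylSA ((Set.Ico (0 : ℤ) (n : ℤ))ᶜ)] (f n)

/-- `{([0,n], f_n)}` is a specification sequence for the family `φfam`. -/
def IsSpecSeqForFam (φfam : Finset ℤ → Conf S → ℝ) (f : ℕ → Conf S → ℝ) : Prop :=
  IsSpecSeq f ∧ ∀ (n : ℕ) (x : Conf S),
    φfam (Finset.Icc (0 : ℤ) (n : ℤ)) x =
      (∏ j ∈ Finset.range (n + 1), f j x) /
        ∑ ζ : (Finset.Icc (0 : ℤ) (n : ℤ)) → S,
          ∏ j ∈ Finset.range (n + 1), f j (ov x (Finset.Icc (0 : ℤ) (n : ℤ)) ζ)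

/-- `{([0,n], f_n)}` is a specification sequence for the specification `V`. -/
def IsSpecSeqFor (V : Specification S) (f : ℕ → Conf S → ℝ) : Prop :=
  IsSpecSeqForFam V.φ f

/-- The operator `L_{m,n} h (x) = ∑_{y ∈ [x]_{[m,n]ᶜ}} (∏_{i=m}^n f_i y) · h y`. -/
def Lop (f : ℕ → Conf S → ℝ) (m n : ℕ) (h : Conf S → ℝ) (x : Conf S) : ℝ :=
  ∑ ζ : (Finset.Icc (m : ℤ) (n : ℤ)) → S,
    (∏ i ∈ Finset.Icc m n, f i (ov x (Finset.Icc (m : ℤ) (n : ℤ)) ζ)) *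
      h (ov x (Finset.Icc (m : ℤ) (n : ℤ)) ζ)

/-- The ratio bounds `ρ_k^{(n)}(x,y)` (with `ρ_{-1}^{(n)}` for negative `k`). -/
def rho (f : ℕ → Conf S → ℝ) (k : ℤ) (n : ℕ) (x y : Conf S) : ℝ :=
  if k < 0 then
    sInf {r : ℝ | ∃ m : ℕ,
      Lop f m (m + n) (fun _ => 1) x / Lop f m (m + n) (fun _ => 1) y = r}
  else
    sInf {r : ℝ | ∃ (m : ℕ) (ζ : (Finset.Icc (m : ℤ) ((m : ℤ) + k)) → S),
      Lop f m (m + n) ((cylEvent (Finset.Icc (m : ℤ) ((m : ℤ) + k)) ζ).indicator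
          fun _ => 1) x /
        Lop f m (m + n) ((cylEvent (Finset.Icc (m : ℤ) ((m : ℤ) + k)) ζ).indicator
          fun _ => 1) y = r}

/-- A `T`-invariant interaction potential `Φ = {Φ_Λ}`. -/
structure Potential (A : Type) [Fintype A] [MeasurableSpace A] where
  Φ : Finset ℤ → Conf A → ℝ
  measurable : ∀ Λ : Finset ℤ, Λ.Nonempty → Measurable[cylSA (↑Λ : Set ℤ)] (Φ Λ)
  bounded : ∀ Λ : Finset ℤ, ∃ C, ∀ x, |Φ Λ x| ≤ C
  invariant : ∀ (n : ℤ) (Λ : Finset ℤ), Λ.Nonempty → ∀ x : Conf A,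
    Φ (Λ.image fun i => n + i) x = Φ Λ (shift n x)

/-- `var(h) = sup h − inf h`. -/
def pvar (h : Conf S → ℝ) : ℝ := (⨆ x, h x) - ⨅ x, h x

/-- `‖h‖ = sup |h|`. -/
def pnorm (h : Conf S → ℝ) : ℝ := ⨆ x, |h x|

/-- `∑_{Λ ∋ 0} ‖Φ_Λ‖ < ∞`. -/
def NormSummable (P : Potential S) : Prop :=
  Summable fun Λ : {Λ : Finset ℤ // (0 : ℤ) ∈ Λ} => pnorm (P.Φ ↑Λ)

/-- `∑_{Λ ∋ 0, Λ ∩ [n,∞) ≠ ∅} var(Φ_Λ)`. -/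
def varTail (P : Potential S) (n : ℕ) : ℝ :=
  ∑' Λ : {Λ : Finset ℤ // (0 : ℤ) ∈ Λ ∧ ∃ i ∈ Λ, (n : ℤ) ≤ i}, pvar (P.Φ ↑Λ)

/-- The Hamiltonian `H_Λ(x) = ∑_{K ∩ Λ ≠ ∅} Φ_K(x)`. -/
def HPot (P : Potential S) (Λ : Finset ℤ) (x : Conf S) : ℝ :=
  ∑' K : {K : Finset ℤ // (K ∩ Λ).Nonempty}, P.Φ ↑K x

/-- The specification `𝒱_Φ` associated with an interaction potential. -/
def potPhi (P : Potential S) (Λ : Finset ℤ) (x : Conf S) : ℝ :=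
  Real.exp (-HPot P Λ x) / ∑ ζ : Λ → S, Real.exp (-HPot P Λ (ov x Λ ζ))

/-- `μ` is a Gibbs state for the potential `P`. -/
def IsGibbsPot (P : Potential S) (μ : Measure (Conf S)) : Prop :=
  IsProbabilityMeasure μ ∧ GibbsCond (potPhi P) μ

/-- `(T,μ)` is Bernoulli: the shift on `(S^ℤ, μ)` is measure-theoretically isomorphic
(mod 0) to the shift on `A^ℤ` carrying an i.i.d. product probability measure for some
finite alphabet `A` (wlog `A = Fin m`). -/
def IsBernoulliSystem (μ : Measure (Conf S)) : Prop :=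
  ∃ (m : ℕ) (p : Fin m → ENNReal) (ν : Measure (ℤ → Fin m)),
    IsProbabilityMeasure ν ∧ (∑ a, p a = 1) ∧
    (∀ (Λ : Finset ℤ) (ζ : Λ → Fin m),
      ν {y : ℤ → Fin m | ∀ i : Λ, y ↑i = ζ i} = ∏ i : Λ, p (ζ i)) ∧
    ∃ (θ : Conf S → ℤ → Fin m) (θinv : (ℤ → Fin m) → Conf S),
      Measurable θ ∧ Measurable θinv ∧ μ.map θ = ν ∧
      (∀ᵐ x ∂μ, θ (shift 1 x) = fun i => θ x (i + 1)) ∧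
      (∀ᵐ x ∂μ, θinv (θ x) = x) ∧ (∀ᵐ y ∂ν, θ (θinv y) = y)

/-- The recursively defined quantities `p_k^{(n)}` of Lemma 3.3 (`k = -1` is encoded
by any negative argument). -/
def pSeq (v : ℕ → ℝ) : ℕ → ℤ → ℝ
  | 0, k => if k < 0 then 1 else v 0
  | n + 1, k =>
    if k < 0 then 1
    else v k.toNat * pSeq v n (k - 1) +
      ∑ j ∈ Finset.Ico k.toNat (n + 1), (v (j + 1) - v j) * pSeq v n (j : ℤ)

section

variable {A : Type}

section Sums

lemma ov_injective (x : Conf A) (Λ : Finset ℤ) : Function.Injective (ov x Λ) := by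
  intro ζ ξ h
  funext i
  simpa [ov] using congrFun h i

/-- The finite set of configurations agreeing with `x` off `Λ`. -/
def cfgs [Fintype A] (Λ : Finset ℤ) (x : Conf A) : Finset (Conf A) :=
  Finset.univ.map ⟨ov x Λ, ov_injective x Λ⟩

variable [Fintype A]

lemma mem_cfgs {Λ : Finset ℤ} {x y : Conf A} : y ∈ cfgs Λ x ↔ ∀ i ∉ Λ, y i = x i := by
  simp only [cfgs, Finset.mem_map, Finset.mem_univ, true_and, Function.Embedding.coeFn_mk]
  constructor
  · rintro ⟨ζ, rfl⟩ i hi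
    simp [ov, hi]
  · intro h
    refine ⟨fun i => y i, ?_⟩
    funext i
    by_cases hi : i ∈ Λ
    · simp [ov, hi]
    · simp [ov, hi, h i hi]

lemma sum_ov (Λ : Finset ℤ) (x : Conf A) (F : Conf A → ℝ) :
    ∑ ζ : Λ → A, F (ov x Λ ζ) = ∑ y ∈ cfgs Λ x, F y := by
  simp [cfgs]

lemma self_mem_cfgs (Λ : Finset ℤ) (x : Conf A) : x ∈ cfgs Λ x :=
  mem_cfgs.2 fun _ _ => rfl

lemma cfgs_congr {Λ : Finset ℤ} {x y : Conf A} (h : ∀ i ∉ Λ, x i = y i) :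
    cfgs Λ x = cfgs Λ y := by
  ext z
  simp only [mem_cfgs]
  exact forall₂_congr fun i hi => by rw [h i hi]

lemma cfgs_eq_of_mem {Λ : Finset ℤ} {x y : Conf A} (h : y ∈ cfgs Λ x) : cfgs Λ y = cfgs Λ x :=
  cfgs_congr (mem_cfgs.1 h)

lemma sum_cfgs_of_subset {K Λ : Finset ℤ} (hK : K ⊆ Λ) (x : Conf A) (F : Conf A → ℝ) :
    ∑ y ∈ cfgs Λ x, F y = ∑ z ∈ cfgs (Λ \ K) x, ∑ y ∈ cfgs K z, F y := by
  classical
  rw [← Finset.sum_fiberwise_of_maps_to (g := fun y => merge K x y) (t := cfgs (Λ \ K) x)]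
  · refine Finset.sum_congr rfl fun z hz => Finset.sum_congr ?_ fun _ _ => rfl
    rw [mem_cfgs] at hz
    ext y
    simp only [Finset.mem_filter, mem_cfgs]
    constructor
    · rintro ⟨-, rfl⟩ i hi
      simp [merge, hi]
    · intro h
      refine ⟨fun i hi => ?_, ?_⟩
      · rw [h i fun h' => hi (hK h'), hz i]
        simp [hi]
      · funext i
        by_cases hi : i ∈ K
        · simp [merge, hi, hz i]
        · simp [merge, hi, h i hi]
  · intro y hy
    rw [mem_cfgs] at hy ⊢
    intro i hi
    by_cases h : i ∈ K
    · simp [merge, h]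
    · simp only [merge, h, if_false]
      exact hy i fun h' => hi (Finset.mem_sdiff.2 ⟨h', h⟩)

lemma sum_cfgs_singleton (i : ℤ) (x : Conf A) (F : Conf A → ℝ) :
    ∑ y ∈ cfgs {i} x, F y = ∑ s : A, F (upd s i x) := by
  refine Finset.sum_bij' (fun y _ => y i) (fun s _ => upd s i x) (by simp) ?_ ?_ ?_ ?_
  · intro s _
    rw [mem_cfgs]
    intro j hj
    simp only [Finset.mem_singleton] at hj
    simp [upd, hj]
  · intro y hy
    rw [mem_cfgs] at hy
    funext j
    by_cases hj : j = i
    · simp [upd, hj]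
    · simp [upd, hj, hy j (by simpa using hj)]
  · intro s _
    simp [upd]
  · intro y hy
    rw [mem_cfgs] at hy
    congr 1
    funext j
    by_cases hj : j = i
    · simp [upd, hj]
    · simp [upd, hj, hy j (by simpa using hj)]

lemma sum_cfgs_shift (n : ℤ) (Λ : Finset ℤ) (x : Conf A) (F : Conf A → ℝ) :
    ∑ y ∈ cfgs (Λ.image fun i => n + i) x, F (shift n y) = ∑ y ∈ cfgs Λ (shift n x), F y := by
  refine Finset.sum_bij' (fun y _ => shift n y) (fun y _ => shift (-n) y) ?_ ?_ ?_ ?_ ?_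
  · intro y hy
    rw [mem_cfgs] at hy ⊢
    intro i hi
    refine hy _ ?_
    simp only [Finset.mem_image, not_exists, not_and]
    intro j hj h
    exact hi ((by omega : j = i) ▸ hj)
  · intro y hy
    rw [mem_cfgs] at hy ⊢
    intro i hi
    rw [shift, hy, shift]
    · congr 1; omega
    · intro h
      exact hi (Finset.mem_image.2 ⟨_, h, by omega⟩)
  · intro y _
    funext i
    simp [shift]
  · intro y _
    funext i
    simp [shift]
  · intro y _
    rfl

end Sums

section Renewal

/-- The lower bounds `q n l` for ratios over windows of `n` sites and observables of the first
`l` sites, given one-step bounds `v`. -/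
def renewalBound (v : ℕ → ℝ) : ℕ → ℕ → ℝ
  | _, 0 => 1
  | 0, _ + 1 => 0
  | n + 1, l + 1 => ∑ j ∈ Finset.Ico l (n + 1),
      v j * (renewalBound v n j - renewalBound v n (j + 1))

/-- The partial sums `∑_{k < n} ∏_{j ≤ k} v j`. -/
def prodSum (v : ℕ → ℝ) (n : ℕ) : ℝ :=
  ∑ k ∈ Finset.range n, ∏ j ∈ Finset.range (k + 1), v j

/-- The increments of `v` on `[l, ∞)`, starting from `v l`. -/
def incr (v : ℕ → ℝ) (l j : ℕ) : ℝ := if j = l then v l else v j - v (j - 1)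

lemma sum_incr_mul (v u : ℕ → ℝ) {l N : ℕ} (h : l ≤ N) :
    ∑ j ∈ Finset.Ico l (N + 1), incr v l j * u j =
      ∑ j ∈ Finset.Ico l (N + 1), v j * (u j - u (j + 1)) + v N * u (N + 1) := by
  induction N, h using Nat.le_induction with
  | base => simp [incr]; ring
  | succ N h ih =>
    rw [Finset.sum_Ico_succ_top (by omega), ih, Finset.sum_Ico_succ_top (b := N + 1) (by omega)]
    have : incr v l (N + 1) = v (N + 1) - v N := by
      rw [incr, if_neg (by omega)]; simp
    rw [this]; ring

lemma sum_incr_mul_of_eq_zero (v u : ℕ → ℝ) {l N : ℕ} (hu : u (N + 1) = 0) :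
    ∑ j ∈ Finset.Ico l (N + 1), v j * (u j - u (j + 1)) =
      ∑ j ∈ Finset.Ico l (N + 1), incr v l j * u j := by
  rcases le_or_gt l N with h | h
  · rw [sum_incr_mul v u h, hu]; ring
  · rw [Finset.Ico_eq_empty (by omega)]; simp

lemma incr_nonneg {v : ℕ → ℝ} (h0 : ∀ j, 0 ≤ v j) (hm : Monotone v) (l j : ℕ) :
    0 ≤ incr v l j := by
  unfold incr
  split_ifs
  · exact h0 l
  · exact sub_nonneg.2 (hm (Nat.sub_le _ _))

@[simp] lemma renewalBound_zero_right (v : ℕ → ℝ) (n : ℕ) : renewalBound v n 0 = 1 := by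
  cases n <;> rfl

lemma renewalBound_eq_zero (v : ℕ → ℝ) : ∀ {n l : ℕ}, n < l → renewalBound v n l = 0
  | 0, l + 1, _ => rfl
  | n + 1, l + 1, h => by
    rw [renewalBound, Finset.Ico_eq_empty (by omega), Finset.sum_empty]

lemma renewalBound_succ_succ (v : ℕ → ℝ) (n l : ℕ) :
    renewalBound v (n + 1) (l + 1) =
      ∑ j ∈ Finset.Ico l (n + 1), incr v l j * renewalBound v n j := by
  rw [renewalBound, sum_incr_mul_of_eq_zero v _ (renewalBound_eq_zero v (Nat.lt_succ_self n))]

lemma renewalBound_diff (v : ℕ → ℝ) {n l : ℕ} (h : l ≤ n) :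
    renewalBound v (n + 1) (l + 1) - renewalBound v (n + 1) (l + 2) =
      v l * (renewalBound v n l - renewalBound v n (l + 1)) := by
  rw [renewalBound, renewalBound, Finset.sum_eq_sum_Ico_succ_bot (by omega)]
  ring

variable {v : ℕ → ℝ}

lemma renewalBound_antitone (h0 : ∀ j, 0 ≤ v j) (h1 : ∀ j, v j ≤ 1) (n : ℕ) :
    Antitone (renewalBound v n) := by
  refine antitone_nat_of_succ_le fun l => ?_
  induction n generalizing l with
  | zero =>
    cases l with
    | zero => simp [renewalBound]
    | succ l => simp [renewalBound]
  | succ n ih =>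
    cases l with
    | zero =>
      calc renewalBound v (n + 1) 1
          = ∑ j ∈ Finset.Ico 0 (n + 1), v j * (renewalBound v n j - renewalBound v n (j + 1)) := rfl
        _ ≤ ∑ j ∈ Finset.Ico 0 (n + 1), (renewalBound v n j - renewalBound v n (j + 1)) :=
            Finset.sum_le_sum fun j _ => mul_le_of_le_one_left (sub_nonneg.2 (ih j)) (h1 j)
        _ = 1 := by
            rw [← Finset.range_eq_Ico, Finset.sum_range_sub',
              renewalBound_eq_zero v (Nat.lt_succ_self n)]
            simp
        _ = _ := by simp
    | succ l =>
      rcases le_or_gt l n with h | h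
      · rw [← sub_nonneg, renewalBound_diff v h]
        exact mul_nonneg (h0 l) (sub_nonneg.2 (ih l))
      · rw [renewalBound_eq_zero v (by omega), renewalBound_eq_zero v (by omega)]

lemma renewalBound_nonneg (h0 : ∀ j, 0 ≤ v j) (h1 : ∀ j, v j ≤ 1) (n l : ℕ) :
    0 ≤ renewalBound v n l := by
  have := renewalBound_antitone h0 h1 n (show l ≤ max l (n + 1) from le_max_left _ _)
  rwa [renewalBound_eq_zero v (lt_of_lt_of_le (Nat.lt_succ_self n) (le_max_right _ _))] at this

lemma renewalBound_le_succ (h0 : ∀ j, 0 ≤ v j) (h1 : ∀ j, v j ≤ 1) (hm : Monotone v) (n l : ℕ) :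
    renewalBound v n l ≤ renewalBound v (n + 1) l := by
  induction n generalizing l with
  | zero =>
    cases l with
    | zero => simp
    | succ l => exact renewalBound_nonneg h0 h1 _ _
  | succ n ih =>
    cases l with
    | zero => simp
    | succ l =>
      rw [renewalBound_succ_succ, renewalBound_succ_succ]
      refine (Finset.sum_le_sum fun j _ =>
        mul_le_mul_of_nonneg_left (ih j) (incr_nonneg h0 hm l j)).trans ?_
      refine Finset.sum_le_sum_of_subset_of_nonneg
        (Finset.Ico_subset_Ico_right (by omega)) fun j _ _ => ?_
      exact mul_nonneg (incr_nonneg h0 hm l j) (renewalBound_nonneg h0 h1 _ _)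

lemma prodSum_nonneg (h0 : ∀ j, 0 ≤ v j) (n : ℕ) : 0 ≤ prodSum v n :=
  Finset.sum_nonneg fun _ _ => Finset.prod_nonneg fun j _ => h0 j

lemma prodSum_mono (h0 : ∀ j, 0 ≤ v j) : Monotone (prodSum v) := fun _ _ h =>
  Finset.sum_le_sum_of_subset_of_nonneg (Finset.range_mono h)
    fun _ _ _ => Finset.prod_nonneg fun j _ => h0 j

lemma renewalBound_add_diff (v : ℕ → ℝ) (n l : ℕ) :
    renewalBound v (n + l) l - renewalBound v (n + l) (l + 1) =
      (∏ j ∈ Finset.range l, v j) * (1 - renewalBound v n 1) := by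
  induction l with
  | zero => simp
  | succ l ih =>
    rw [← add_assoc, renewalBound_diff v (by omega), ih, Finset.prod_range_succ]
    ring

lemma div_le_renewalBound (h0 : ∀ j, 0 ≤ v j) (h1 : ∀ j, v j ≤ 1) (hm : Monotone v) (n : ℕ) :
    prodSum v n / (1 + prodSum v n) ≤ renewalBound v n 1 := by
  have hmono : Monotone fun n => renewalBound v n 1 :=
    monotone_nat_of_le_succ fun n => renewalBound_le_succ h0 h1 hm n 1
  have key : (1 + prodSum v n) * (1 - renewalBound v n 1) ≤ 1 := by
    calc (1 + prodSum v n) * (1 - renewalBound v n 1)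
        = ∑ l ∈ Finset.range (n + 1),
            (∏ j ∈ Finset.range l, v j) * (1 - renewalBound v n 1) := by
          rw [Finset.sum_range_succ', ← Finset.sum_mul, prodSum]
          simp; ring
      _ ≤ ∑ l ∈ Finset.range (n + 1), (renewalBound v n l - renewalBound v n (l + 1)) := by
          refine Finset.sum_le_sum fun l hl => ?_
          have hl : l ≤ n := by simpa [Nat.lt_succ_iff] using hl
          have := renewalBound_add_diff v (n - l) l
          rw [Nat.sub_add_cancel hl] at this
          rw [this]
          exact mul_le_mul_of_nonneg_left (sub_le_sub_left (hmono (Nat.sub_le n l)) 1)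
            (Finset.prod_nonneg fun j _ => h0 j)
      _ = 1 := by
          rw [Finset.sum_range_sub', renewalBound_eq_zero v (Nat.lt_succ_self n)]
          simp
  have := prodSum_nonneg h0 n
  rw [div_le_iff₀ (by linarith)]
  linarith

end Renewal

section Ratio

variable [Fintype A]

/-- The operator `h ↦ ∑ (∏ f_i) h` over the window `[m, m + n)`. -/
def winOp (f : ℕ → Conf A → ℝ) (m n : ℕ) (h : Conf A → ℝ) (x : Conf A) : ℝ :=
  ∑ y ∈ cfgs (Finset.Ico (m : ℤ) (m + n)) x, (∏ i ∈ Finset.range n, f (m + i) y) * h y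

variable {f : ℕ → Conf A → ℝ}

lemma winOp_mono (hf : ∀ n x, 0 < f n x) {P : Set ℤ} (hP : P ⊆ Set.Iio 0) {m n : ℕ}
    {h h' : Conf A → ℝ} {x : Conf A} (hh : ∀ z, (∀ i ∈ P, z i = x i) → h z ≤ h' z) :
    winOp f m n h x ≤ winOp f m n h' x := by
  refine Finset.sum_le_sum fun z hz => mul_le_mul_of_nonneg_left (hh z fun i hi => ?_)
    (Finset.prod_nonneg fun i _ => (hf _ _).le)
  refine mem_cfgs.1 hz i fun h => ?_
  have h₁ := Finset.mem_Ico.1 h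
  have h₂ : i < 0 := hP hi
  omega

lemma winOp_sub (m n : ℕ) (h h' : Conf A → ℝ) (x : Conf A) :
    winOp f m n (fun z => h z - h' z) x = winOp f m n h x - winOp f m n h' x := by
  simp [winOp, mul_sub]

lemma winOp_const_mul (m n : ℕ) (c : ℝ) (h : Conf A → ℝ) (x : Conf A) :
    winOp f m n (fun z => c * h z) x = c * winOp f m n h x := by
  simp only [winOp, Finset.mul_sum]
  exact Finset.sum_congr rfl fun _ _ => by ring

lemma winOp_one_pos (hf : ∀ n x, 0 < f n x) (m n : ℕ) (x : Conf A) :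
    0 < winOp f m n (fun _ => 1) x :=
  Finset.sum_pos (fun _ _ => mul_pos (Finset.prod_pos fun _ _ => hf _ _) one_pos)
    ⟨x, self_mem_cfgs _ x⟩

lemma winOp_succ (hfd : ∀ n : ℕ, DependsOn (f n) (Set.Ico (0 : ℤ) n)ᶜ) (m n : ℕ)
    (h : Conf A → ℝ) (x : Conf A) :
    winOp f m (n + 1) h x =
      winOp f (m + 1) n (fun z => ∑ s : A, f m (upd s m z) * h (upd s m z)) x := by
  have hsub : ({(m : ℤ)} : Finset ℤ) ⊆ Finset.Ico (m : ℤ) (m + (n + 1 : ℕ)) := by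
    intro i
    simp only [Finset.mem_singleton, Finset.mem_Ico]
    omega
  have hsd : Finset.Ico (m : ℤ) (m + (n + 1 : ℕ)) \ {(m : ℤ)} =
      Finset.Ico ((m + 1 : ℕ) : ℤ) ((m + 1 : ℕ) + n) := by
    ext i
    simp only [Finset.mem_sdiff, Finset.mem_Ico, Finset.mem_singleton]
    omega
  rw [winOp, sum_cfgs_of_subset hsub, hsd, winOp]
  refine Finset.sum_congr rfl fun z _ => ?_
  rw [sum_cfgs_singleton, Finset.mul_sum]
  refine Finset.sum_congr rfl fun s _ => ?_
  rw [Finset.prod_range_succ', add_zero, mul_assoc]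
  congr 1
  refine Finset.prod_congr rfl fun i _ => ?_
  rw [show m + (i + 1) = m + 1 + i by omega]
  refine hfd _ fun k hk => ?_
  have : k ≠ m := by
    rintro rfl
    exact hk ⟨by omega, by push_cast; omega⟩
  simp [upd, this]

/-- The largest function of the coordinates in `J` lying below `H` on the configurations that
agree with `x` on `P`. -/
def lowerEnv (P : Set ℤ) (x : Conf A) (H : Conf A → ℝ) (J : Set ℤ) (z : Conf A) : ℝ :=
  ⨅ z' : {z' : Conf A // (∀ i ∈ P, z' i = x i) ∧ ∀ i ∈ J, z' i = z i}, H z'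

section LowerEnv

variable {P : Set ℤ} {x : Conf A} {H : Conf A → ℝ} {J J' : Set ℤ}

omit [Fintype A] in
lemma lowerEnv_nonneg (hH : ∀ z, 0 ≤ H z) (z : Conf A) : 0 ≤ lowerEnv P x H J z :=
  Real.iInf_nonneg fun _ => hH _

omit [Fintype A] in
lemma lowerEnv_dependsOn : DependsOn (lowerEnv P x H J) J := by
  intro z w hzw
  have : (fun z' : Conf A => (∀ i ∈ P, z' i = x i) ∧ ∀ i ∈ J, z' i = z i) =
      fun z' => (∀ i ∈ P, z' i = x i) ∧ ∀ i ∈ J, z' i = w i := by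
    funext z'
    exact propext (and_congr_right fun _ => forall₂_congr fun i hi => by rw [hzw i hi])
  unfold lowerEnv
  rw [this]

omit [Fintype A] in
lemma bddBelow_of_nonneg {ι : Type*} {F : ι → ℝ} (hF : ∀ i, 0 ≤ F i) :
    BddBelow (Set.range F) :=
  ⟨0, by rintro _ ⟨i, rfl⟩; exact hF i⟩

omit [Fintype A] in
lemma lowerEnv_le (hH : ∀ z, 0 ≤ H z) {z : Conf A} (hz : ∀ i ∈ P, z i = x i) :
    lowerEnv P x H J z ≤ H z :=
  ciInf_le (bddBelow_of_nonneg fun _ => hH _)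
    (⟨z, hz, fun _ _ => rfl⟩ : {z' : Conf A // (∀ i ∈ P, z' i = x i) ∧ ∀ i ∈ J, z' i = z i})

omit [Fintype A] in
lemma le_lowerEnv (hJ : Disjoint P J) {z : Conf A} {c : ℝ}
    (hc : ∀ z', (∀ i ∈ P, z' i = x i) → (∀ i ∈ J, z' i = z i) → c ≤ H z') :
    c ≤ lowerEnv P x H J z := by
  classical
  have : Nonempty {z' : Conf A // (∀ i ∈ P, z' i = x i) ∧ ∀ i ∈ J, z' i = z i} := by
    refine ⟨fun i => if i ∈ J then z i else x i, fun i hi => ?_, fun i hi => by simp [hi]⟩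
    simp [Set.disjoint_left.1 hJ hi]
  exact le_ciInf fun z' => hc z' z'.2.1 z'.2.2

omit [Fintype A] in
lemma lowerEnv_mono (hH : ∀ z, 0 ≤ H z) (hJJ : J ⊆ J') (hJ : Disjoint P J') (z : Conf A) :
    lowerEnv P x H J z ≤ lowerEnv P x H J' z := by
  refine le_lowerEnv hJ fun z' h₁ h₂ => ?_
  rw [lowerEnv_dependsOn (P := P) (x := x) (H := H) fun i hi => (h₂ i (hJJ hi)).symm]
  exact lowerEnv_le hH h₁

end LowerEnv

/-- `ρ l` bounds from below the ratios `winOp h x / winOp h y` for nonnegative observables `h`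
of the first `l` sites of the window `[m, m + n)`. -/
structure RatioBound (f : ℕ → Conf A → ℝ) (m n : ℕ) (x y : Conf A) (ρ : ℕ → ℝ) : Prop where
  antitone : Antitone ρ
  eq_zero : ∀ l, n < l → ρ l = 0
  le : ∀ (l : ℕ) (h : Conf A → ℝ), (∀ z, 0 ≤ h z) → DependsOn h (Set.Ico (m : ℤ) (m + l)) →
    ρ l * winOp f m n h y ≤ winOp f m n h x

lemma RatioBound.nonneg {m n : ℕ} {x y : Conf A} {ρ : ℕ → ℝ} (h : RatioBound f m n x y ρ)
    (l : ℕ) : 0 ≤ ρ l := by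
  have := h.antitone (le_max_left l (n + 1))
  rwa [h.eq_zero _ (lt_of_lt_of_le (Nat.lt_succ_self n) (le_max_right _ _))] at this

/-- `f i` changes by a factor of at least `v j` between configurations that agree on `P` and
on `[i, i + j]`. -/
def VarBound (f : ℕ → Conf A → ℝ) (P : Set ℤ) (v : ℕ → ℝ) : Prop :=
  ∀ (i j : ℕ) (a b : Conf A), (∀ k ∈ P, a k = b k) →
    (∀ k ∈ Set.Icc (i : ℤ) (i + j), a k = b k) → v j * f i b ≤ f i a

/-- The one-step recursion for ratio bounds. -/
def nextBound (v : ℕ → ℝ) (n : ℕ) (r : ℝ) (ρ : ℕ → ℝ) : ℕ → ℝ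
  | 0 => r
  | l + 1 => ∑ j ∈ Finset.Ico l (n + 1), v j * (ρ j - ρ (j + 1))

lemma RatioBound.le_next {P : Set ℤ} {v : ℕ → ℝ} (hf : ∀ n x, 0 < f n x)
    (hfd : ∀ n : ℕ, DependsOn (f n) (Set.Ico (0 : ℤ) n)ᶜ) (hP : P ⊆ Set.Iio 0)
    (hv : VarBound f P v) {x y : Conf A} (hxy : ∀ i ∈ P, x i = y i) {m n : ℕ} {ρ : ℕ → ℝ}
    (hρ : RatioBound f (m + 1) n x y ρ) (l : ℕ) {h : Conf A → ℝ} (hh : ∀ z, 0 ≤ h z)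
    (hd : DependsOn h (Set.Ico (m : ℤ) (m + (l + 1 : ℕ)))) :
    (∑ j ∈ Finset.Ico l (n + 1), v j * (ρ j - ρ (j + 1))) * winOp f m (n + 1) h y ≤
      winOp f m (n + 1) h x := by
  rw [winOp_succ hfd, winOp_succ hfd]
  set H : Conf A → ℝ := fun z => ∑ s : A, f m (upd s m z) * h (upd s m z) with hHdef
  have hH : ∀ z, 0 ≤ H z := fun z =>
    Finset.sum_nonneg fun s _ => mul_nonneg (hf _ _).le (hh _)
  let J : ℕ → Set ℤ := fun j => Set.Ico ((m + 1 : ℕ) : ℤ) ((m + 1 : ℕ) + j)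
  have hJ : ∀ j, Disjoint P (J j) := fun j => Set.disjoint_left.2 fun i hi hi' => by
    have h₁ : i < 0 := hP hi
    have h₂ := hi'.1
    omega
  have hJm : ∀ j, J j ⊆ J (j + 1) := fun j =>
    Set.Ico_subset_Ico_right (by push_cast; omega)
  let E : ℕ → Conf A → ℝ := fun j => lowerEnv P x H (J j)
  have hlow : ∀ j, l ≤ j → v j * winOp f (m + 1) n H y ≤ winOp f (m + 1) n (E j) y := by
    intro j hj
    rw [← winOp_const_mul]
    refine winOp_mono hf hP fun z hz => le_lowerEnv (hJ j) fun z' hz' hzz' => ?_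
    rw [hHdef]
    simp only
    rw [Finset.mul_sum]
    refine Finset.sum_le_sum fun s _ => ?_
    have hE : ∀ k ∈ Set.Icc (m : ℤ) (m + j), upd s m z' k = upd s m z k := by
      intro k hk
      by_cases hkm : k = m
      · simp [upd, hkm]
      · have := hzz' k ⟨by have := hk.1; omega, by have := hk.2; push_cast; omega⟩
        simp [upd, hkm, this]
    have hhE : h (upd s m z) = h (upd s m z') := by
      refine hd fun k hk => (hE k ⟨hk.1, ?_⟩).symm
      have := hk.2
      push_cast at this
      omega
    rw [hhE, ← mul_assoc]
    refine mul_le_mul_of_nonneg_right (hv m j _ _ (fun k hk => ?_) hE) (hh _)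
    have : k ≠ m := by
      have : k < 0 := hP hk
      omega
    simp [upd, this, hz' k hk, hz k hk, hxy k hk]
  have hsum : ∀ N, l ≤ N → ∑ j ∈ Finset.Ico l N,
      (ρ j - ρ (j + 1)) * winOp f (m + 1) n (E j) y + ρ N * winOp f (m + 1) n (E N) y ≤
        winOp f (m + 1) n (E N) x := by
    intro N hN
    induction N, hN using Nat.le_induction with
    | base =>
      simpa using hρ.le l (E l) (lowerEnv_nonneg hH) lowerEnv_dependsOn
    | succ N hN ih =>
      rw [Finset.sum_Ico_succ_top hN]
      have := hρ.le (N + 1) (fun z => E (N + 1) z - E N z)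
        (fun z => sub_nonneg.2 (lowerEnv_mono hH (hJm N) (hJ _) z))
        (fun z w hzw => by
          have h₁ : E (N + 1) z = E (N + 1) w := lowerEnv_dependsOn hzw
          have h₂ : E N z = E N w := lowerEnv_dependsOn fun i hi => hzw i (hJm N hi)
          simp only [h₁, h₂])
      rw [winOp_sub, winOp_sub] at this
      nlinarith
  rcases le_or_gt l n with hln | hln
  · have h₁ := hsum (n + 1) (by omega)
    rw [hρ.eq_zero _ (Nat.lt_succ_self n), zero_mul, add_zero] at h₁
    rw [Finset.sum_mul]
    refine (Finset.sum_le_sum fun j hj => ?_).trans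
      (h₁.trans (winOp_mono hf hP fun z hz => lowerEnv_le hH hz))
    have h₂ := hlow j (Finset.mem_Ico.1 hj).1
    have h₃ := hρ.antitone (Nat.le_succ j)
    calc v j * (ρ j - ρ (j + 1)) * winOp f (m + 1) n H y
        = (ρ j - ρ (j + 1)) * (v j * winOp f (m + 1) n H y) := by ring
      _ ≤ _ := mul_le_mul_of_nonneg_left h₂ (sub_nonneg.2 h₃)
  · rw [Finset.Ico_eq_empty (by omega), Finset.sum_empty, zero_mul]
    exact Finset.sum_nonneg fun z _ =>
      mul_nonneg (Finset.prod_nonneg fun i _ => (hf _ _).le) (hH z)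

lemma RatioBound.next {P : Set ℤ} {v : ℕ → ℝ} (h0 : ∀ j, 0 ≤ v j)
    (hf : ∀ n x, 0 < f n x)
    (hfd : ∀ n : ℕ, DependsOn (f n) (Set.Ico (0 : ℤ) n)ᶜ) (hP : P ⊆ Set.Iio 0)
    (hv : VarBound f P v) {x y : Conf A} (hxy : ∀ i ∈ P, x i = y i) {m n : ℕ} {ρ : ℕ → ℝ}
    (hρ : RatioBound f (m + 1) n x y ρ) :
    RatioBound f m (n + 1) x y (nextBound v n
      (winOp f m (n + 1) (fun _ => 1) x / winOp f m (n + 1) (fun _ => 1) y) ρ) where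
  antitone := by
    refine antitone_nat_of_succ_le fun l => ?_
    cases l with
    | zero =>
      rw [nextBound, nextBound, le_div_iff₀ (winOp_one_pos hf _ _ _)]
      exact hρ.le_next hf hfd hP hv hxy 0 (fun _ => zero_le_one) fun _ _ _ => rfl
    | succ l =>
      refine Finset.sum_le_sum_of_subset_of_nonneg
        (Finset.Ico_subset_Ico_left (by omega)) fun j _ _ => ?_
      exact mul_nonneg (h0 j) (sub_nonneg.2 (hρ.antitone (Nat.le_succ j)))
  eq_zero := by
    rintro (_ | l) hl
    · omega
    · rw [nextBound, Finset.Ico_eq_empty (by omega), Finset.sum_empty]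
  le := by
    rintro (_ | l) h hh hd
    · obtain ⟨c, hc⟩ : ∃ c, h = fun z => c * 1 :=
        ⟨h x, funext fun z => by rw [mul_one]; exact hd fun i hi => by simp at hi⟩
      rw [hc, winOp_const_mul, winOp_const_mul, nextBound]
      apply le_of_eq
      field_simp [(winOp_one_pos hf m (n + 1) y).ne']
    · exact hρ.le_next hf hfd hP hv hxy l hh hd

lemma exists_ratioBound {P : Set ℤ} {v : ℕ → ℝ} (h0 : ∀ j, 0 ≤ v j)
    (hm : Monotone v) (hf : ∀ n x, 0 < f n x)
    (hfd : ∀ n : ℕ, DependsOn (f n) (Set.Ico (0 : ℤ) n)ᶜ) (hP : P ⊆ Set.Iio 0)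
    (hv : VarBound f P v) {x y : Conf A} (hxy : ∀ i ∈ P, x i = y i) (n m : ℕ) :
    ∃ ρ τ, RatioBound f m n x y ρ ∧ RatioBound f m n y x τ ∧
      ∀ l, renewalBound v n l ^ 2 ≤ ρ l * τ l := by
  induction n generalizing m with
  | zero =>
    have base : ∀ a b : Conf A, RatioBound f m 0 a b fun l => if l = 0 then 1 else 0 := by
      intro a b
      refine ⟨antitone_nat_of_succ_le fun l => ?_, fun l hl => by simp [hl.ne'], ?_⟩
      · split_ifs <;> simp_all
      · rintro (_ | l) h hh hd
        · have hW : ∀ z, winOp f m 0 h z = h a := by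
            intro z
            refine (Finset.sum_congr rfl fun w _ =>
              show _ = (1 : ℝ) * h a from ?_).trans ?_
            · rw [Finset.prod_range_zero, hd (y := a) fun i hi => by simp at hi]
            · simp [cfgs]
          simp [hW]
        · simp only [Nat.add_eq_zero_iff, one_ne_zero, and_false, if_false, zero_mul]
          exact Finset.sum_nonneg fun z _ => by simpa using hh z
    refine ⟨_, _, base x y, base y x, ?_⟩
    rintro (_ | l)
    · simp
    · simp [renewalBound]
  | succ n ih =>
    obtain ⟨ρ, τ, hρ, hτ, hq⟩ := ih (m + 1)
    refine ⟨_, _, hρ.next h0 hf hfd hP hv hxy,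
      hτ.next h0 hf hfd hP hv fun i hi => (hxy i hi).symm, ?_⟩
    rintro (_ | l)
    · have h₁ := (winOp_one_pos hf m (n + 1) y).ne'
      have h₂ := (winOp_one_pos hf m (n + 1) x).ne'
      simp only [renewalBound_zero_right, nextBound]
      apply le_of_eq
      field_simp
    · simp only [nextBound]
      rw [renewalBound_succ_succ, sum_incr_mul_of_eq_zero v _ (hρ.eq_zero _ (Nat.lt_succ_self n)),
        sum_incr_mul_of_eq_zero v _ (hτ.eq_zero _ (Nat.lt_succ_self n))]
      refine Finset.sum_sq_le_sum_mul_sum_of_sq_le_mul _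
        (fun j _ => mul_nonneg (incr_nonneg h0 hm l j) (hρ.nonneg j))
        (fun j _ => mul_nonneg (incr_nonneg h0 hm l j) (hτ.nonneg j)) fun j _ => ?_
      calc (incr v l j * renewalBound v n j) ^ 2
          = incr v l j ^ 2 * renewalBound v n j ^ 2 := by ring
        _ ≤ incr v l j ^ 2 * (ρ j * τ j) := mul_le_mul_of_nonneg_left (hq j) (sq_nonneg _)
        _ = _ := by ring

lemma winOp_ratio_le {P : Set ℤ} {v : ℕ → ℝ} (h0 : ∀ j, 0 ≤ v j)
    (h1 : ∀ j, v j ≤ 1)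
    (hm : Monotone v) (hf : ∀ n x, 0 < f n x)
    (hfd : ∀ n : ℕ, DependsOn (f n) (Set.Ico (0 : ℤ) n)ᶜ) (hP : P ⊆ Set.Iio 0)
    (hv : VarBound f P v) {x y : Conf A} (hxy : ∀ i ∈ P, x i = y i) (n : ℕ)
    {h : Conf A → ℝ} (hh : ∀ z, 0 ≤ h z) (hd : DependsOn h {0}) :
    (prodSum v n / (1 + prodSum v n)) ^ 2 *
        (winOp f 0 n h y / winOp f 0 n (fun _ => 1) y) ≤
      winOp f 0 n h x / winOp f 0 n (fun _ => 1) x := by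
  obtain ⟨ρ, τ, hρ, hτ, hq⟩ := exists_ratioBound h0 hm hf hfd hP hv hxy n 0
  have hx := winOp_one_pos hf 0 n x
  have hy := winOp_one_pos hf 0 n y
  have hhy : 0 ≤ winOp f 0 n h y := Finset.sum_nonneg fun z _ =>
      mul_nonneg (Finset.prod_nonneg fun i _ => (hf _ _).le) (hh z)
  have b₁ := hρ.le 1 h hh fun z w hzw => hd fun i hi => by
    rw [Set.mem_singleton_iff.1 hi]; exact hzw 0 (by simp)
  have b₂ := hτ.le 1 (fun _ => 1) (fun _ => zero_le_one) fun _ _ _ => rfl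
  have hc : (prodSum v n / (1 + prodSum v n)) ^ 2 ≤ ρ 1 * τ 1 := by
    refine le_trans (pow_le_pow_left₀ ?_ (div_le_renewalBound h0 h1 hm n) 2) (hq 1)
    have := prodSum_nonneg h0 n
    positivity
  rw [← mul_div_assoc, div_le_div_iff₀ hy hx]
  calc (prodSum v n / (1 + prodSum v n)) ^ 2 * winOp f 0 n h y * winOp f 0 n (fun _ => 1) x
      ≤ (ρ 1 * τ 1) * (winOp f 0 n h y * winOp f 0 n (fun _ => 1) x) := by
        rw [mul_assoc]
        exact mul_le_mul_of_nonneg_right hc (mul_nonneg hhy hx.le)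
    _ = (ρ 1 * winOp f 0 n h y) * (τ 1 * winOp f 0 n (fun _ => 1) x) := by ring
    _ ≤ winOp f 0 n h x * winOp f 0 n (fun _ => 1) y := by
        refine mul_le_mul b₁ b₂ (mul_nonneg (hτ.nonneg 1) hx.le) ?_
        exact (mul_nonneg (hρ.nonneg 1) hhy).trans b₁

end Ratio

section Cylinder

variable [MeasurableSpace A] {Λ : Set ℤ}

lemma dependsOn_of_measurable {F : Conf A → ℝ} (h : Measurable[cylSA Λ] F) : DependsOn F Λ :=
  dependsOn_iff_factorsThrough.2 h.factorsThrough

lemma measurable_cylSA {F : Conf A → ℝ} (hF : Measurable F) (hd : DependsOn F Λ) :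
    Measurable[cylSA Λ] F := by
  classical
  rcases isEmpty_or_nonempty (Conf A) with he | ⟨⟨w⟩⟩
  · intro t _
    exact ⟨∅, MeasurableSet.empty, Subsingleton.elim _ _⟩
  · let e : (Λ → A) → Conf A := fun z i => if h : i ∈ Λ then z ⟨i, h⟩ else w i
    have he : Measurable e := by
      refine measurable_pi_lambda _ fun i => ?_
      by_cases h : i ∈ Λ
      · simpa [e, h] using measurable_pi_apply (⟨i, h⟩ : Λ)
      · simp [e, h]
    have hFe : F = (F ∘ e) ∘ Λ.domRestrict := by
      funext x
      exact hd fun i hi => by simp [e, hi]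
    rw [hFe]
    exact (hF.comp he).comp (comap_measurable _)

lemma cylSA_le : (cylSA Λ : MeasurableSpace (Conf A)) ≤ MeasurableSpace.pi :=
  Measurable.comap_le (measurable_pi_lambda _ fun _ => measurable_pi_apply _)

lemma cylSA_mono {Λ' : Set ℤ} (h : Λ ⊆ Λ') :
    (cylSA Λ : MeasurableSpace (Conf A)) ≤ cylSA Λ' := by
  have : Measurable fun (z : Λ' → A) (i : Λ) => z ⟨i, h i.2⟩ :=
    measurable_pi_lambda _ fun i => measurable_pi_apply _
  rintro _ ⟨t, ht, rfl⟩
  exact ⟨_, this ht, rfl⟩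

lemma measurable_upd (s : A) (n : ℤ) : Measurable (upd s n) := by
  refine measurable_pi_lambda _ fun i => ?_
  by_cases h : i = n
  · simp [upd, h]
  · simpa [upd, h] using measurable_pi_apply i

lemma measurable_shift (n : ℤ) : Measurable (shift n : Conf A → Conf A) :=
  measurable_pi_lambda _ fun i => measurable_pi_apply (i + n)

lemma measurable_ov (Λ : Finset ℤ) (ζ : Λ → A) : Measurable fun x => ov x Λ ζ := by
  refine measurable_pi_lambda _ fun i => ?_
  by_cases h : i ∈ Λ
  · simp [ov, h]
  · simpa [ov, h] using measurable_pi_apply i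

omit [MeasurableSpace A] in
lemma continuous_ov [TopologicalSpace A] (Λ : Finset ℤ) (ζ : Λ → A) :
    Continuous fun x => ov x Λ ζ := by
  refine continuous_pi fun i => ?_
  by_cases h : i ∈ Λ
  · simpa [ov, h] using continuous_const
  · simpa [ov, h] using continuous_apply i

/-- The indicator of the event that the symbol at site `b` is `s`. -/
def site [DecidableEq A] (b : ℤ) (s : A) (y : Conf A) : ℝ := if y b = s then 1 else 0

variable [DecidableEq A]

omit [MeasurableSpace A] in
lemma site_nonneg (b : ℤ) (s : A) (y : Conf A) : 0 ≤ site b s y := by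
  unfold site; split_ifs <;> simp

omit [MeasurableSpace A] in
lemma site_le_one (b : ℤ) (s : A) (y : Conf A) : site b s y ≤ 1 := by
  unfold site; split_ifs <;> simp

omit [MeasurableSpace A] in
lemma site_eq_indicator (b : ℤ) (s : A) :
    site b s = ({y : Conf A | y b = s}).indicator fun _ => (1 : ℝ) := by
  funext y
  simp [site, Set.indicator]

omit [MeasurableSpace A] in
lemma site_dependsOn (b : ℤ) (s : A) : DependsOn (site b s) {b} := by
  intro x y h
  simp [site, h b rfl]

lemma measurable_site [MeasurableSingletonClass A] (b : ℤ) (s : A) : Measurable (site b s) :=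
  have h : MeasurableSet {y : Conf A | y b = s} :=
    (measurable_pi_apply b : Measurable fun y : Conf A => y b) (measurableSet_singleton s)
  Measurable.ite h measurable_const measurable_const

omit [MeasurableSpace A] in
lemma continuous_site [TopologicalSpace A] [DiscreteTopology A] (b : ℤ) (s : A) :
    Continuous (site b s) :=
  (continuous_of_discreteTopology (f := fun t : A => if t = s then (1 : ℝ) else 0)).comp
    (continuous_apply b)

end Cylinder

section Average

variable [Fintype A] [MeasurableSpace A]

/-- The expectation `∑_{y ∈ [x]_{Λᶜ}} φ_Λ(y) F(y)`. -/
def Specification.avg (V : Specification A) (Λ : Finset ℤ) (F : Conf A → ℝ) (x : Conf A) : ℝ :=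
  ∑ y ∈ cfgs Λ x, V.φ Λ y * F y

variable {V : Specification A}

lemma Specification.sum_cfgs_phi (Λ : Finset ℤ) (x : Conf A) : ∑ y ∈ cfgs Λ x, V.φ Λ y = 1 := by
  rw [← sum_ov, V.sum_one]

lemma Specification.phi_eq {K Λ : Finset ℤ} (h : K ⊆ Λ) (x : Conf A) :
    V.φ Λ x = V.φ K x * ∑ y ∈ cfgs K x, V.φ Λ y := by
  rw [← sum_ov, ← V.consistent K Λ h]

lemma Specification.avg_mul {Λ : Finset ℤ} {h F : Conf A → ℝ} {x : Conf A}
    (hh : ∀ y, (∀ i ∉ Λ, y i = x i) → h y = h x) :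
    V.avg Λ (fun y => h y * F y) x = h x * V.avg Λ F x := by
  rw [avg, avg, Finset.mul_sum]
  refine Finset.sum_congr rfl fun y hy => ?_
  rw [hh y (mem_cfgs.1 hy)]
  ring

lemma Specification.avg_one (Λ : Finset ℤ) (x : Conf A) : V.avg Λ (fun _ => 1) x = 1 := by
  simp [avg, V.sum_cfgs_phi]

lemma Specification.avg_of_forall_eq {Λ : Finset ℤ} {F : Conf A → ℝ} {x : Conf A}
    (hh : ∀ y, (∀ i ∉ Λ, y i = x i) → F y = F x) : V.avg Λ F x = F x := by
  simpa [V.avg_one] using V.avg_mul (F := fun _ => 1) hh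

lemma Specification.avg_sub (Λ : Finset ℤ) (F G : Conf A → ℝ) (x : Conf A) :
    V.avg Λ (fun y => F y - G y) x = V.avg Λ F x - V.avg Λ G x := by
  simp [avg, mul_sub]

lemma Specification.avg_sum {ι : Type*} (t : Finset ι) (Λ : Finset ℤ) (F : ι → Conf A → ℝ)
    (x : Conf A) : V.avg Λ (fun y => ∑ j ∈ t, F j y) x = ∑ j ∈ t, V.avg Λ (F j) x := by
  simp only [avg, Finset.mul_sum]
  exact Finset.sum_comm

lemma Specification.avg_mono {Λ : Finset ℤ} {F G : Conf A → ℝ} {x : Conf A}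
    (hh : ∀ y, (∀ i ∉ Λ, y i = x i) → F y ≤ G y) : V.avg Λ F x ≤ V.avg Λ G x :=
  Finset.sum_le_sum fun y hy => mul_le_mul_of_nonneg_left (hh y (mem_cfgs.1 hy)) (V.nonneg _ _)

lemma Specification.avg_const (Λ : Finset ℤ) (c : ℝ) (x : Conf A) :
    V.avg Λ (fun _ => c) x = c := V.avg_of_forall_eq fun _ _ => rfl

lemma Specification.abs_avg_le {Λ : Finset ℤ} {F : Conf A → ℝ} {C : ℝ} (hF : ∀ y, |F y| ≤ C)
    (x : Conf A) : |V.avg Λ F x| ≤ C := by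
  rw [abs_le]
  constructor
  · rw [← V.avg_const Λ (-C) x]
    exact V.avg_mono fun y _ => (abs_le.1 (hF y)).1
  · rw [← V.avg_const Λ C x]
    exact V.avg_mono fun y _ => (abs_le.1 (hF y)).2

lemma Specification.avg_avg {K Λ : Finset ℤ} (h : K ⊆ Λ) (F : Conf A → ℝ) (x : Conf A) :
    V.avg Λ (V.avg K F) x = V.avg Λ F x := by
  rw [avg, avg, sum_cfgs_of_subset h, sum_cfgs_of_subset h]
  refine Finset.sum_congr rfl fun z _ => ?_
  have h₁ : ∀ y ∈ cfgs K z, V.avg K F y = V.avg K F z := fun y hy => by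
    rw [avg, avg, cfgs_eq_of_mem hy]
  have h₂ : ∀ y ∈ cfgs K z, V.φ Λ y = V.φ K y * ∑ w ∈ cfgs K z, V.φ Λ w := fun y hy => by
    rw [V.phi_eq h, cfgs_eq_of_mem hy]
  rw [Finset.sum_congr rfl fun y hy => by rw [h₁ y hy], ← Finset.sum_mul, avg, Finset.mul_sum]
  refine Finset.sum_congr rfl fun y hy => ?_
  rw [h₂ y hy]
  ring

lemma Specification.measurable_avg (Λ : Finset ℤ) {F : Conf A → ℝ} (hF : Measurable F) :
    Measurable (V.avg Λ F) := by
  have : V.avg Λ F = fun x => ∑ ζ : Λ → A, V.φ Λ (ov x Λ ζ) * F (ov x Λ ζ) := by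
    funext x
    rw [avg, sum_ov Λ x fun y => V.φ Λ y * F y]
  rw [this]
  exact Finset.measurable_sum _ fun ζ _ =>
    ((V.measurable Λ).comp (measurable_ov Λ ζ)).mul (hF.comp (measurable_ov Λ ζ))

lemma Specification.continuous_avg [TopologicalSpace A] (hV : V.IsCont) (Λ : Finset ℤ)
    {F : Conf A → ℝ} (hF : Continuous F) : Continuous (V.avg Λ F) := by
  have : V.avg Λ F = fun x => ∑ ζ : Λ → A, V.φ Λ (ov x Λ ζ) * F (ov x Λ ζ) := by
    funext x
    rw [avg, sum_ov Λ x fun y => V.φ Λ y * F y]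
  rw [this]
  exact continuous_finsetSum _ fun ζ _ =>
    ((hV Λ).comp (continuous_ov Λ ζ)).mul (hF.comp (continuous_ov Λ ζ))

lemma Specification.avg_shift (hinv : V.TInvariant) (b : ℤ) (Λ : Finset ℤ) (F : Conf A → ℝ)
    (x : Conf A) :
    V.avg (Λ.image fun i => b + i) (fun y => F (shift b y)) x = V.avg Λ F (shift b x) := by
  rw [avg, avg, ← sum_cfgs_shift b Λ x fun y => V.φ Λ y * F y]
  exact Finset.sum_congr rfl fun y _ => by rw [hinv]

variable [DecidableEq A]

lemma Specification.avg_site_shift (hinv : V.TInvariant) (b : ℤ) (n : ℕ) (s : A) (x : Conf A) :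
    V.avg (Finset.Icc b (b + n)) (site b s) x =
      V.avg (Finset.Icc 0 (n : ℤ)) (site 0 s) (shift b x) := by
  rw [← V.avg_shift hinv]
  have h₁ : (Finset.Icc 0 (n : ℤ)).image (fun i => b + i) = Finset.Icc b (b + n) := by
    rw [Finset.image_add_left_Icc, add_zero]
  have h₂ : (fun y => site 0 s (shift b y)) = site b s := by
    funext y
    simp [site, shift]
  rw [h₁, h₂]

lemma piG_eq_avg (n : ℕ) (x : Conf A) :
    piG V n x = V.avg (Finset.Icc 0 (n : ℤ)) (site 0 (x 0)) x := by
  rw [piG, Specification.avg, sum_ov _ x fun y => V.φ _ y * (if y 0 = x 0 then 1 else 0)]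
  rfl

lemma Specification.sum_avg_site (Λ : Finset ℤ) (b : ℤ) (x : Conf A) :
    ∑ s : A, V.avg Λ (site b s) x = 1 := by
  rw [← V.avg_sum]
  have : (fun y : Conf A => ∑ s : A, site b s y) = fun _ => 1 := by
    funext y
    simp [site]
  rw [this, V.avg_one]

lemma Specification.avg_site_pos (hpos : V.Positive) {Λ : Finset ℤ} {b : ℤ} (hb : b ∈ Λ)
    (s : A) (x : Conf A) : 0 < V.avg Λ (site b s) x := by
  refine Finset.sum_pos' (fun y _ => mul_nonneg (V.nonneg _ _) (site_nonneg b s y))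
    ⟨upd s b x, mem_cfgs.2 fun i hi => ?_, ?_⟩
  · have : i ≠ b := fun h => hi (h ▸ hb)
    simp [upd, this]
  · simpa [site, upd] using hpos _ _

end Average
section InfBound

lemma rInf_mul_le {F : Conf A → ℝ} (hF : ∀ x, 0 < F x) {Λ : Set ℤ} {a b : Conf A}
    (h : ∀ i ∈ Λ, a i = b i) : rInf Λ F * F b ≤ F a := by
  rw [← le_div_iff₀ (hF b)]
  refine csInf_le ⟨0, ?_⟩ ⟨a, b, h, rfl⟩
  rintro _ ⟨x, y, -, rfl⟩
  exact (div_pos (hF x) (hF y)).le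

lemma rInf_nonneg {F : Conf A → ℝ} (hF : ∀ x, 0 < F x) (Λ : Set ℤ) : 0 ≤ rInf Λ F := by
  refine Real.sInf_nonneg ?_
  rintro _ ⟨x, y, -, rfl⟩
  exact (div_pos (hF x) (hF y)).le

lemma rInf_mono [Nonempty A] {F : Conf A → ℝ} (hF : ∀ x, 0 < F x) {Λ Λ' : Set ℤ} (h : Λ ⊆ Λ') :
    rInf Λ F ≤ rInf Λ' F := by
  obtain ⟨w⟩ : Nonempty (Conf A) := inferInstance
  refine csInf_le_csInf ⟨0, ?_⟩ ⟨_, w, w, fun _ _ => rfl, rfl⟩ ?_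
  · rintro _ ⟨x, y, -, rfl⟩
    exact (div_pos (hF x) (hF y)).le
  · rintro _ ⟨x, y, hxy, rfl⟩
    exact ⟨x, y, fun i hi => hxy i (h hi), rfl⟩

/-- The uniform lower bounds `inf_i r̄_{Λ (i + j)}(f_i)`. -/
def infBound (f : ℕ → Conf A → ℝ) (Λ : ℤ → Set ℤ) (j : ℕ) : ℝ :=
  ⨅ i : ℕ, rInf (Λ ((i : ℤ) + (j : ℤ))) (f i)

variable {f : ℕ → Conf A → ℝ} {Λ : ℤ → Set ℤ}

lemma infBound_le (hf : ∀ n x, 0 < f n x) (i j : ℕ) :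
    infBound f Λ j ≤ rInf (Λ ((i : ℤ) + (j : ℤ))) (f i) :=
  ciInf_le ⟨0, by rintro _ ⟨i, rfl⟩; exact rInf_nonneg (hf i) _⟩ i

lemma infBound_nonneg (hf : ∀ n x, 0 < f n x) (j : ℕ) : 0 ≤ infBound f Λ j :=
  le_ciInf fun i => rInf_nonneg (hf i) _

lemma infBound_le_one [Nonempty A] (hf : ∀ n x, 0 < f n x) (j : ℕ) : infBound f Λ j ≤ 1 := by
  obtain ⟨w⟩ : Nonempty (Conf A) := inferInstance
  refine (infBound_le hf 0 j).trans ?_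
  have := rInf_mul_le (hf 0) (Λ := Λ (((0 : ℕ) : ℤ) + (j : ℤ))) (a := w) (b := w) fun _ _ => rfl
  exact le_of_mul_le_mul_right (by simpa using this) (hf 0 w)

lemma infBound_mono [Nonempty A] (hf : ∀ n x, 0 < f n x) (hΛ : Monotone Λ) :
    Monotone (infBound f Λ) := fun j j' h =>
  le_ciInf fun i => (infBound_le hf i j).trans (rInf_mono (hf i) (hΛ (by omega)))

lemma varBound_infBound {P : Set ℤ} (hf : ∀ n x, 0 < f n x)
    (hfd : ∀ n : ℕ, DependsOn (f n) (Set.Ico (0 : ℤ) n)ᶜ) (hΛ : ∀ t, Λ t ⊆ P ∪ Set.Icc 0 t) :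
    VarBound f P (infBound f Λ) := by
  intro i j a b hP hJ
  have hb : f i (merge (Finset.Ico 0 (i : ℤ)) a b) = f i b :=
    hfd i fun k hk => by
      have hk : ¬(0 ≤ k ∧ k < i) := hk
      simp [merge, hk]
  rw [← hb]
  refine (mul_le_mul_of_nonneg_right (infBound_le hf i j) (hf i _).le).trans
    (rInf_mul_le (hf i) fun k hk => ?_)
  by_cases h : k ∈ Finset.Ico 0 (i : ℤ)
  · simp only [merge, h, if_true]
  · simp only [merge, h, if_false]
    rcases hΛ _ hk with h' | h'
    · exact hP k h'
    · rw [Finset.mem_Ico] at h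
      exact hJ k ⟨by have := h'.1; omega, h'.2⟩

end InfBound

section Window

variable [Fintype A] [MeasurableSpace A] {V : Specification A} {f : ℕ → Conf A → ℝ}

lemma Specification.avg_eq_winOp (hseq : IsSpecSeqFor V f) (n : ℕ) (F : Conf A → ℝ) (x : Conf A) :
    V.avg (Finset.Icc 0 (n : ℤ)) F x =
      winOp f 0 (n + 1) F x / winOp f 0 (n + 1) (fun _ => 1) x := by
  have hI : Finset.Ico ((0 : ℕ) : ℤ) (((0 : ℕ) : ℤ) + ((n + 1 : ℕ) : ℤ)) =
      Finset.Icc 0 (n : ℤ) := by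
    ext i
    simp only [Finset.mem_Ico, Finset.mem_Icc]
    omega
  rw [avg, winOp, winOp, hI, Finset.sum_div]
  refine Finset.sum_congr rfl fun y hy => ?_
  rw [hseq.2 n y, sum_ov _ y fun z => ∏ j ∈ Finset.range (n + 1), f j z, cfgs_eq_of_mem hy]
  simp only [zero_add, mul_one]
  ring

/-- The comparison constant obtained from one-step bounds `v` on the window `[0, n]`. -/
def winRate (v : ℕ → ℝ) (n : ℕ) : ℝ := (prodSum v (n + 1) / (1 + prodSum v (n + 1))) ^ 2

lemma Specification.avg_site_ratio [Nonempty A] [DecidableEq A] (hseq : IsSpecSeqFor V f)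
    {Λ : ℤ → Set ℤ} (hΛm : Monotone Λ) {P : Set ℤ} (hP : P ⊆ Set.Iio 0)
    (hΛ : ∀ t, Λ t ⊆ P ∪ Set.Icc 0 t) {x y : Conf A} (hxy : ∀ i ∈ P, x i = y i) (n : ℕ) (s : A) :
    winRate (infBound f Λ) n * V.avg (Finset.Icc 0 (n : ℤ)) (site 0 s) y ≤
      V.avg (Finset.Icc 0 (n : ℤ)) (site 0 s) x := by
  have hf : ∀ n x, 0 < f n x := fun n => (hseq.1 n).2.1
  have hfd : ∀ n : ℕ, DependsOn (f n) (Set.Ico (0 : ℤ) n)ᶜ :=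
    fun n => dependsOn_of_measurable (hseq.1 n).2.2
  rw [V.avg_eq_winOp hseq, V.avg_eq_winOp hseq]
  exact winOp_ratio_le (infBound_nonneg hf) (infBound_le_one hf) (infBound_mono hf hΛm) hf hfd hP
    (varBound_infBound hf hfd hΛ) hxy (n + 1) (site_nonneg 0 s) (site_dependsOn 0 s)

lemma winRate_le_one {v : ℕ → ℝ} (h0 : ∀ j, 0 ≤ v j) (n : ℕ) : winRate v n ≤ 1 := by
  have := prodSum_nonneg h0 (n + 1)
  exact pow_le_one₀ (by positivity) (div_le_one_of_le₀ (by linarith) (by linarith))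

lemma tendsto_winRate {v : ℕ → ℝ} (h : Tendsto (fun n => prodSum v (n + 1)) atTop atTop) :
    Tendsto (winRate v) atTop (nhds 1) := by
  have h₁ : Tendsto (fun n => (1 + prodSum v (n + 1))⁻¹) atTop (nhds 0) :=
    tendsto_inv_atTop_zero.comp (tendsto_atTop_add_const_left _ 1 h)
  have h₂ : Tendsto (fun n => (1 - (1 + prodSum v (n + 1))⁻¹) ^ 2) atTop (nhds 1) := by
    simpa using (h₁.const_sub 1).pow 2
  refine h₂.congr' ?_
  filter_upwards [h.eventually_ge_atTop 0] with n hn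
  have : 1 + prodSum v (n + 1) ≠ 0 := by linarith
  rw [winRate]
  congr 1
  field_simp
  ring

end Window
section Limit

lemma winRate_mono {v : ℕ → ℝ} (h0 : ∀ j, 0 ≤ v j) : Monotone (winRate v) := by
  intro m n h
  have h₁ := prodSum_nonneg h0 (m + 1)
  have h₂ := prodSum_mono h0 (Nat.succ_le_succ h)
  refine pow_le_pow_left₀ (by positivity) ?_ 2
  simp only [Nat.succ_eq_add_one] at h₂
  rw [div_le_div_iff₀ (by linarith) (by linarith)]
  linarith

variable [Fintype A] [MeasurableSpace A] [DecidableEq A] {V : Specification A}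

/-- The conditional probabilities of the symbol at `0` on the window `[0, n]` converge to `γ`
uniformly at rate `ε`. -/
structure Specification.HasLimit (V : Specification A) (γ : A → Conf A → ℝ) (ε : ℕ → ℝ) :
    Prop where
  rate : Tendsto ε atTop (nhds 0)
  abs_sub_le : ∀ (n : ℕ) s x, |V.avg (Finset.Icc 0 (n : ℤ)) (site 0 s) x - γ s x| ≤ ε n

lemma Specification.avg_site_nonneg (Λ : Finset ℤ) (b : ℤ) (s : A) (x : Conf A) :
    0 ≤ V.avg Λ (site b s) x :=
  Finset.sum_nonneg fun _ _ => mul_nonneg (V.nonneg _ _) (site_nonneg _ _ _)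

lemma Specification.avg_site_le_one (Λ : Finset ℤ) (b : ℤ) (s : A) (x : Conf A) :
    V.avg Λ (site b s) x ≤ 1 := by
  rw [← V.avg_one Λ x]
  exact V.avg_mono fun y _ => site_le_one b s y

variable {f : ℕ → Conf A → ℝ}

lemma Specification.avg_site_compare [Nonempty A] (hseq : IsSpecSeqFor V f) {n M : ℕ} (h : n ≤ M)
    (s : A) (x : Conf A) :
    winRate (infBound f Set.Iic) n * V.avg (Finset.Icc 0 (n : ℤ)) (site 0 s) x ≤
        V.avg (Finset.Icc 0 (M : ℤ)) (site 0 s) x ∧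
      winRate (infBound f Set.Iic) n * V.avg (Finset.Icc 0 (M : ℤ)) (site 0 s) x ≤
        V.avg (Finset.Icc 0 (n : ℤ)) (site 0 s) x := by
  have hsub : Finset.Icc 0 (n : ℤ) ⊆ Finset.Icc 0 (M : ℤ) :=
    Finset.Icc_subset_Icc_right (by exact_mod_cast h)
  have hΛ : ∀ t : ℤ, Set.Iic t ⊆ Set.Iio 0 ∪ Set.Icc 0 t := fun t k hk => by
    rcases lt_or_ge k 0 with h | h
    · exact Or.inl h
    · exact Or.inr ⟨h, hk⟩
  have hm : Monotone (Set.Iic : ℤ → Set ℤ) := monotone_Iic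
  have hagree : ∀ y : Conf A, (∀ i ∉ Finset.Icc 0 (M : ℤ), y i = x i) →
      ∀ i ∈ Set.Iio (0 : ℤ), y i = x i := fun y hy i hi => by
    refine hy i fun h => ?_
    have h₁ := (Finset.mem_Icc.1 h).1
    have h₂ : i < 0 := hi
    omega
  have hc := V.avg_avg hsub (site 0 s) x
  constructor
  · rw [← hc, ← V.avg_const (Finset.Icc 0 (M : ℤ)) (winRate (infBound f Set.Iic) n * _) x]
    exact V.avg_mono fun y hy => V.avg_site_ratio hseq hm le_rfl hΛ (hagree y hy) n s
  · have : V.avg (Finset.Icc 0 (M : ℤ)) (fun y => winRate (infBound f Set.Iic) n *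
        V.avg (Finset.Icc 0 (n : ℤ)) (site 0 s) y) x ≤
          V.avg (Finset.Icc 0 (n : ℤ)) (site 0 s) x := by
      rw [← V.avg_const (Finset.Icc 0 (M : ℤ)) (V.avg (Finset.Icc 0 (n : ℤ)) (site 0 s) x) x]
      exact V.avg_mono fun y hy =>
        V.avg_site_ratio hseq hm le_rfl hΛ (fun i hi => (hagree y hy i hi).symm) n s
    rwa [V.avg_mul fun _ _ => rfl, hc] at this

lemma Specification.exists_hasLimit [Nonempty A] (hseq : IsSpecSeqFor V f)
    (hdiv : Tendsto (fun n => prodSum (infBound f Set.Iic) (n + 1)) atTop atTop) :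
    ∃ γ, V.HasLimit γ fun n => 1 - winRate (infBound f Set.Iic) n := by
  have h0 := infBound_nonneg (Λ := Set.Iic) fun n => (hseq.1 n).2.1
  have hrate : Tendsto (fun n => 1 - winRate (infBound f Set.Iic) n) atTop (nhds 0) := by
    simpa using (tendsto_winRate hdiv).const_sub 1
  have hdist : ∀ (s : A) (x : Conf A) (n M : ℕ), n ≤ M →
      dist (V.avg (Finset.Icc 0 (n : ℤ)) (site 0 s) x)
        (V.avg (Finset.Icc 0 (M : ℤ)) (site 0 s) x) ≤ 1 - winRate (infBound f Set.Iic) n := by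
    intro s x n M h
    obtain ⟨h₁, h₂⟩ := V.avg_site_compare hseq h s x
    have h₃ := V.avg_site_le_one (Finset.Icc 0 (n : ℤ)) 0 s x
    have h₄ := V.avg_site_le_one (Finset.Icc 0 (M : ℤ)) 0 s x
    have h₅ := winRate_le_one h0 n
    rw [Real.dist_eq, abs_le]
    constructor <;> nlinarith
  have hex : ∀ (s : A) (x : Conf A), ∃ l, Tendsto
      (fun n : ℕ => V.avg (Finset.Icc 0 (n : ℤ)) (site 0 s) x) atTop (nhds l) := fun s x =>
    cauchySeq_tendsto_of_complete (cauchySeq_of_le_tendsto_0' _ (hdist s x) hrate)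
  choose γ hγ using hex
  refine ⟨γ, hrate, fun n s x => ?_⟩
  rw [← Real.dist_eq]
  exact le_of_tendsto (tendsto_const_nhds.dist (hγ s x))
    ((eventually_ge_atTop n).mono fun M h => hdist s x n M h)

variable {γ : A → Conf A → ℝ} {ε : ℕ → ℝ}

lemma Specification.HasLimit.tendsto (hγ : V.HasLimit γ ε) (s : A) (x : Conf A) :
    Tendsto (fun n : ℕ => V.avg (Finset.Icc 0 (n : ℤ)) (site 0 s) x) atTop (nhds (γ s x)) := by
  rw [tendsto_iff_dist_tendsto_zero]
  exact squeeze_zero (fun _ => dist_nonneg) (fun n => hγ.abs_sub_le n s x) hγ.rate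

lemma Specification.HasLimit.nonneg (hγ : V.HasLimit γ ε) (s : A) (x : Conf A) : 0 ≤ γ s x :=
  ge_of_tendsto' (hγ.tendsto s x) fun _ => V.avg_site_nonneg _ _ _ _

lemma Specification.HasLimit.le_one (hγ : V.HasLimit γ ε) (s : A) (x : Conf A) : γ s x ≤ 1 :=
  le_of_tendsto' (hγ.tendsto s x) fun _ => V.avg_site_le_one _ _ _ _

lemma Specification.HasLimit.sum_eq_one (hγ : V.HasLimit γ ε) (x : Conf A) :
    ∑ s, γ s x = 1 := by
  refine tendsto_nhds_unique (tendsto_finsetSum Finset.univ fun s _ => hγ.tendsto s x) ?_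
  simp only [V.sum_avg_site]
  exact tendsto_const_nhds

lemma Specification.HasLimit.measurable [MeasurableSingletonClass A] (hγ : V.HasLimit γ ε)
    (s : A) : Measurable (γ s) :=
  measurable_of_tendsto_metrizable (fun n : ℕ => V.measurable_avg (Finset.Icc 0 (n : ℤ))
    (measurable_site 0 s)) (tendsto_pi_nhds.2 (hγ.tendsto s))

lemma Specification.HasLimit.continuous [TopologicalSpace A] [DiscreteTopology A]
    (hγ : V.HasLimit γ ε) (hV : V.IsCont) (s : A) : Continuous (γ s) := by
  have hu : TendstoUniformly (fun n : ℕ => V.avg (Finset.Icc 0 (n : ℤ)) (site 0 s)) (γ s)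
      atTop := by
    rw [Metric.tendstoUniformly_iff]
    intro e he
    filter_upwards [hγ.rate.eventually_lt_const he] with n hn x
    rw [dist_comm]
    exact (hγ.abs_sub_le n s x).trans_lt hn
  exact hu.continuous (Eventually.frequently (Eventually.of_forall fun n =>
    V.continuous_avg hV _ (continuous_site 0 s)))

lemma Specification.HasLimit.ratio_le [Nonempty A] (hγ : V.HasLimit γ ε)
    (hseq : IsSpecSeqFor V f)
    {Λ : ℤ → Set ℤ} (hΛm : Monotone Λ) {P : Set ℤ} (hP : P ⊆ Set.Iio 0)
    (hΛ : ∀ t, Λ t ⊆ P ∪ Set.Icc 0 t) {x y : Conf A} (hxy : ∀ i ∈ P, x i = y i) (n : ℕ) (s : A) :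
    winRate (infBound f Λ) n * γ s y ≤ γ s x := by
  refine le_of_tendsto_of_tendsto ((hγ.tendsto s y).const_mul _) (hγ.tendsto s x) ?_
  filter_upwards [eventually_ge_atTop n] with M hM
  exact (mul_le_mul_of_nonneg_right
    (winRate_mono (infBound_nonneg fun n => (hseq.1 n).2.1) hM) (V.avg_site_nonneg _ _ _ _)).trans
    (V.avg_site_ratio hseq hΛm hP hΛ hxy M s)

variable [Nonempty A]

lemma Specification.HasLimit.dependsOn (hγ : V.HasLimit γ ε) (hseq : IsSpecSeqFor V f)
    (hdiv : Tendsto (fun n => prodSum (infBound f Set.Iic) (n + 1)) atTop atTop) (s : A) :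
    DependsOn (γ s) (Set.Iio 0) := by
  have key : ∀ x y : Conf A, (∀ i ∈ Set.Iio (0 : ℤ), x i = y i) → γ s y ≤ γ s x := by
    intro x y hxy
    refine le_of_tendsto' (by simpa using (tendsto_winRate hdiv).mul_const (γ s y) :
      Tendsto (fun n => winRate (infBound f Set.Iic) n * γ s y) atTop (nhds (γ s y))) fun n => ?_
    refine hγ.ratio_le hseq monotone_Iic le_rfl (fun t k hk => ?_) hxy n s
    rcases lt_or_ge k 0 with h | h
    · exact Or.inl h
    · exact Or.inr ⟨h, hk⟩
  exact fun x y h => le_antisymm (key y x fun i hi => (h i hi).symm) (key x y h)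

lemma Specification.HasLimit.pos (hγ : V.HasLimit γ ε) (hpos : V.Positive)
    (hseq : IsSpecSeqFor V f)
    (hdiv : Tendsto (fun n => prodSum (infBound f Set.Iic) (n + 1)) atTop atTop) (s : A)
    (x : Conf A) : 0 < γ s x := by
  obtain ⟨n, hn⟩ := ((tendsto_winRate hdiv).eventually_const_lt zero_lt_one).exists
  refine lt_of_lt_of_le (mul_pos hn (V.avg_site_pos hpos (Λ := Finset.Icc 0 (n : ℤ)) (b := 0)
    (by simp) s x)) (ge_of_tendsto (hγ.tendsto s x) ?_)
  filter_upwards [eventually_ge_atTop n] with M hM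
  exact (V.avg_site_compare hseq hM s x).1

omit [Fintype A] [MeasurableSpace A] [DecidableEq A] [Nonempty A] in
lemma ofReal_rSup_le {F : Conf A → ℝ} {Λ : Set ℤ} {B : ENNReal}
    (h : ∀ x y, (∀ i ∈ Λ, x i = y i) → ENNReal.ofReal (F x / F y) ≤ B) :
    ENNReal.ofReal (rSup Λ F) ≤ B := by
  rcases eq_or_ne B ⊤ with rfl | hB
  · exact le_top
  · rw [ENNReal.ofReal_le_iff_le_toReal hB]
    refine Real.sSup_le ?_ ENNReal.toReal_nonneg
    rintro _ ⟨x, y, hxy, rfl⟩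
    exact (ENNReal.ofReal_le_iff_le_toReal hB).1 (h x y hxy)

lemma ofReal_le_of_winRate_mul_le {v : ℕ → ℝ} (h0 : ∀ j, 0 ≤ v j) {q : ℝ}
    (h : ∀ n, winRate v n * q ≤ 1) :
    ENNReal.ofReal q ≤
      (1 + (∑' k : ℕ, ENNReal.ofReal (∏ j ∈ Finset.range (k + 1), v j))⁻¹) ^ 2 := by
  have hlim : Tendsto (fun n => (1 + (∑ k ∈ Finset.range (n + 1),
      ENNReal.ofReal (∏ j ∈ Finset.range (k + 1), v j))⁻¹) ^ 2) atTop
      (nhds ((1 + (∑' k : ℕ, ENNReal.ofReal (∏ j ∈ Finset.range (k + 1), v j))⁻¹) ^ 2)) := by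
    have h₁ := (tendsto_add_atTop_iff_nat 1).2
      (ENNReal.tendsto_nat_tsum fun k => ENNReal.ofReal (∏ j ∈ Finset.range (k + 1), v j))
    exact ENNReal.Tendsto.pow (tendsto_const_nhds.add (tendsto_inv_iff.2 h₁))
  refine ge_of_tendsto' hlim fun n => ?_
  rw [← ENNReal.ofReal_sum_of_nonneg fun k _ => Finset.prod_nonneg fun j _ => h0 j]
  change _ ≤ (1 + (ENNReal.ofReal (prodSum v (n + 1)))⁻¹) ^ 2
  rcases (prodSum_nonneg h0 (n + 1)).eq_or_lt with hR | hR
  · simp [← hR]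
  · rw [← ENNReal.ofReal_inv_of_pos hR, ← ENNReal.ofReal_one,
      ← ENNReal.ofReal_add zero_le_one (inv_nonneg.2 hR.le), ← ENNReal.ofReal_pow (by positivity)]
    refine ENNReal.ofReal_le_ofReal ?_
    have h₁ := h n
    rw [winRate, div_pow, div_mul_eq_mul_div, div_le_one (by positivity)] at h₁
    have h₂ : (1 + (prodSum v (n + 1))⁻¹) ^ 2 =
        (1 + prodSum v (n + 1)) ^ 2 / prodSum v (n + 1) ^ 2 := by
      field_simp
      ring
    rw [h₂, le_div_iff₀ (by positivity)]
    linarith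

lemma Specification.HasLimit.rSup_le (hγ : V.HasLimit γ ε) (hpos : ∀ s x, 0 < γ s x)
    (hseq : IsSpecSeqFor V f) (n : ℕ) :
    ENNReal.ofReal (rSup (Set.Icc (-(n : ℤ)) 0) fun x => γ (x 0) x) ≤
      (1 + (∑' k : ℕ, ENNReal.ofReal (∏ j ∈ Finset.range (k + 1),
        infBound f (fun t => Set.Icc (-(n : ℤ)) t) j))⁻¹) ^ 2 := by
  refine ofReal_rSup_le fun x y hxy =>
    ofReal_le_of_winRate_mul_le (infBound_nonneg fun n => (hseq.1 n).2.1) fun N => ?_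
  rw [hxy 0 (by simp), mul_div_assoc', div_le_one (hpos _ _)]
  refine hγ.ratio_le hseq (P := Set.Ico (-(n : ℤ)) 0)
    (fun a b h => Set.Icc_subset_Icc_right h) (fun i hi => hi.2) (fun t k hk => ?_)
    (fun i hi => (hxy i ⟨hi.1, hi.2.le⟩).symm) N (y 0)
  rcases lt_or_ge k 0 with h | h
  · exact Or.inl ⟨hk.1, h⟩
  · exact Or.inr ⟨h, hk.2⟩

omit [Nonempty A] in
lemma Specification.HasLimit.tendstoUniformly (hγ : V.HasLimit γ ε) :
    TendstoUniformly (fun n : ℕ => fun x : Conf A => piG V n x) (fun x => γ (x 0) x) atTop := by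
  rw [Metric.tendstoUniformly_iff]
  intro e he
  filter_upwards [hγ.rate.eventually_lt_const he] with n hn x
  rw [dist_comm, piG_eq_avg]
  exact (hγ.abs_sub_le n _ x).trans_lt hn

omit [MeasurableSpace A] [Nonempty A] in
lemma apply_symbol_eq_sum (γ : A → Conf A → ℝ) (x : Conf A) :
    γ (x 0) x = ∑ s, site 0 s x * γ s x := by
  simp [site]

omit [Nonempty A] in
lemma Specification.HasLimit.memG [MeasurableSingletonClass A] (hγ : V.HasLimit γ ε)
    (hd : ∀ s, DependsOn (γ s) (Set.Iio 0)) : MemG fun x => γ (x 0) x := by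
  refine ⟨⟨1, fun x => ?_⟩, fun x => hγ.nonneg _ x, measurable_cylSA ?_ ?_, fun x => ?_⟩
  · rw [abs_of_nonneg (hγ.nonneg _ x)]
    exact hγ.le_one _ x
  · simp only [apply_symbol_eq_sum γ]
    exact Finset.measurable_sum _ fun s _ => (measurable_site 0 s).mul (hγ.measurable s)
  · intro x y h
    simp only [h 0 (by simp)]
    exact hd _ fun i hi => h i (Set.Iio_subset_Iic_self hi)
  · rw [← hγ.sum_eq_one x]
    refine Finset.sum_congr rfl fun s _ => ?_
    have h₀ : upd s 0 x 0 = s := by simp [upd]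
    change γ (upd s 0 x 0) (upd s 0 x) = γ s x
    rw [h₀]
    refine hd s fun i hi => ?_
    have : i ≠ 0 := ne_of_lt hi
    simp [upd, this]

end Limit
section Integrals

variable [MeasurableSpace A] {μ : Measure (Conf A)}

lemma integrable_of_abs_le [IsFiniteMeasure μ] {F : Conf A → ℝ} (hF : Measurable F) {C : ℝ}
    (hC : ∀ x, |F x| ≤ C) : Integrable F μ :=
  Integrable.of_bound hF.aestronglyMeasurable C (Eventually.of_forall hC)

lemma tendsto_setIntegral_of_abs_sub_le [IsFiniteMeasure μ] {u : ℕ → Conf A → ℝ}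
    {F : Conf A → ℝ} {δ : ℕ → ℝ} (hδ : Tendsto δ atTop (nhds 0)) (hu : ∀ n, Integrable (u n) μ)
    (hF : Integrable F μ) (h : ∀ n x, |u n x - F x| ≤ δ n) (B : Set (Conf A)) :
    Tendsto (fun n => ∫ x in B, u n x ∂μ) atTop (nhds (∫ x in B, F x ∂μ)) := by
  rw [tendsto_iff_dist_tendsto_zero]
  refine squeeze_zero (fun _ => dist_nonneg) (fun n => ?_)
    (by simpa using hδ.mul_const (μ.real B))
  rw [Real.dist_eq, ← integral_sub (hu n).integrableOn hF.integrableOn, ← Real.norm_eq_abs]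
  exact norm_setIntegral_le_of_norm_le_const (measure_lt_top μ B) fun x _ => h n x

lemma integrable_site [MeasurableSingletonClass A] [DecidableEq A] [IsFiniteMeasure μ] (b : ℤ)
    (s : A) : Integrable (site b s) μ :=
  integrable_of_abs_le (C := 1) (measurable_site b s) fun x => by
    rw [abs_of_nonneg (site_nonneg _ _ _)]
    exact site_le_one _ _ _

omit [MeasurableSpace A] in
lemma ov_self (x : Conf A) (Λ : Finset ℤ) : ov x Λ (fun i => x i) = x := by
  funext i
  by_cases h : i ∈ Λ <;> simp [ov, h]

omit [MeasurableSpace A] in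
lemma mem_cylEvent_ov {Λ : Finset ℤ} {ζ ξ : Λ → A} {x : Conf A} :
    ov x Λ ζ ∈ cylEvent Λ ξ ↔ ζ = ξ := by
  rw [funext_iff]
  exact forall_congr' fun i => by simp [ov]

lemma measurableSet_cylEvent [MeasurableSingletonClass A] (Λ : Finset ℤ) (ζ : Λ → A) :
    MeasurableSet (cylEvent Λ ζ) := by
  rw [cylEvent, ofPred_forall]
  exact MeasurableSet.iInter fun i =>
    (measurable_pi_apply (i : ℤ) : Measurable fun y : Conf A => y i) (measurableSet_singleton (ζ i))

end Integrals

section GibbsToChain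

variable [Fintype A] [MeasurableSpace A] {V : Specification A}

lemma Specification.avg_mul_cylEvent {Λ : Finset ℤ} (ζ : Λ → A) (F : Conf A → ℝ) (x : Conf A) :
    V.avg Λ (fun y => F y * (cylEvent Λ ζ).indicator (fun _ => 1) y) x =
      F (ov x Λ ζ) * V.φ Λ (ov x Λ ζ) := by
  classical
  rw [avg, ← sum_ov Λ x fun y => V.φ Λ y * (F y * (cylEvent Λ ζ).indicator (fun _ => 1) y),
    Finset.sum_eq_single ζ]
  · rw [indicator_of_mem (mem_cylEvent_ov.2 rfl)]
    ring
  · intro ξ _ h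
    rw [indicator_of_notMem (mt mem_cylEvent_ov.1 h)]
    ring
  · simp

lemma phi_ov_dependsOn (Λ : Finset ℤ) (ζ : Λ → A) :
    DependsOn (fun x => V.φ Λ (ov x Λ ζ)) (↑Λ : Set ℤ)ᶜ := by
  intro x y h
  have : ov x Λ ζ = ov y Λ ζ := by
    funext i
    by_cases hi : i ∈ Λ
    · simp [ov, hi]
    · simp [ov, hi, h i (by simpa using hi)]
  simp only [this]

variable (V) in
lemma Specification.phi_le_one (Λ : Finset ℤ) (x : Conf A) : V.φ Λ x ≤ 1 := by
  rw [← V.sum_cfgs_phi Λ x]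
  exact Finset.single_le_sum (f := V.φ Λ) (fun y _ => V.nonneg _ _) (self_mem_cfgs Λ x)

variable [MeasurableSingletonClass A] {μ : Measure (Conf A)}

lemma GibbsCond.setIntegral_cylEvent [IsProbabilityMeasure μ] (h : GibbsCond V.φ μ)
    {Λ : Finset ℤ} (hΛ : Λ.Nonempty) (ζ : Λ → A) {B : Set (Conf A)}
    (hB : MeasurableSet[cylSA ((↑Λ : Set ℤ)ᶜ)] B) :
    ∫ x in B, (cylEvent Λ ζ).indicator (fun _ => (1 : ℝ)) x ∂μ =
      ∫ x in B, V.φ Λ (ov x Λ ζ) ∂μ := by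
  rw [← setIntegral_condExp cylSA_le
    ((integrable_const (1 : ℝ)).indicator (measurableSet_cylEvent Λ ζ)) hB]
  exact integral_congr_ae (ae_restrict_of_ae (h Λ hΛ ζ).symm)

lemma GibbsCond.setIntegral_avg [IsProbabilityMeasure μ] [Nonempty A] (h : GibbsCond V.φ μ)
    {Λ : Finset ℤ} (hΛ : Λ.Nonempty) {F : Conf A → ℝ} (hF : DependsOn F (↑Λ : Set ℤ))
    {B : Set (Conf A)} (hB : MeasurableSet[cylSA ((↑Λ : Set ℤ)ᶜ)] B) :
    ∫ x in B, F x ∂μ = ∫ x in B, V.avg Λ F x ∂μ := by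
  classical
  obtain ⟨w⟩ : Nonempty (Conf A) := inferInstance
  have hov : ∀ x (ζ : Λ → A), F (ov x Λ ζ) = F (ov w Λ ζ) := fun x ζ => hF fun i hi => by
    have : i ∈ Λ := hi
    simp [ov, this]
  have h₁ : ∀ x, F x = ∑ ζ : Λ → A, F (ov w Λ ζ) * (cylEvent Λ ζ).indicator (fun _ => 1) x := by
    intro x
    rw [Finset.sum_eq_single fun i : Λ => x i]
    · rw [indicator_of_mem (by simp [cylEvent]), mul_one, ← hov x, ov_self]
    · intro ζ _ hζ
      rw [indicator_of_notMem, mul_zero]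
      exact fun hx => hζ (funext fun i => (hx i).symm)
    · simp
  have h₂ : ∀ x, V.avg Λ F x = ∑ ζ : Λ → A, F (ov w Λ ζ) * V.φ Λ (ov x Λ ζ) := by
    intro x
    rw [Specification.avg, ← sum_ov Λ x fun y => V.φ Λ y * F y]
    exact Finset.sum_congr rfl fun ζ _ => by rw [hov, mul_comm]
  simp only [h₂]
  rw [integral_congr_ae (Eventually.of_forall h₁), integral_finsetSum, integral_finsetSum]
  · refine Finset.sum_congr rfl fun ζ _ => ?_
    rw [integral_const_mul, integral_const_mul, h.setIntegral_cylEvent hΛ ζ hB]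
  · refine fun ζ _ => ((integrable_of_abs_le (C := 1)
      ((V.measurable Λ).comp (measurable_ov Λ ζ)) fun x => ?_).const_mul _).integrableOn
    rw [Function.comp_apply, abs_of_nonneg (V.nonneg _ _)]
    exact V.phi_le_one _ _
  · exact fun ζ _ => (((integrable_const (1 : ℝ)).indicator
      (measurableSet_cylEvent Λ ζ)).const_mul _).integrableOn

variable [DecidableEq A] {γ : A → Conf A → ℝ} {ε : ℕ → ℝ}

omit [MeasurableSingletonClass A] in
lemma Specification.HasLimit.abs_avg_sub_le (hγ : V.HasLimit γ ε) (hinv : V.TInvariant) (b : ℤ)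
    (n : ℕ) (s : A) (x : Conf A) :
    |V.avg (Finset.Icc b (b + n)) (site b s) x - γ s (shift b x)| ≤ ε n := by
  rw [V.avg_site_shift hinv]
  exact hγ.abs_sub_le n s _

omit [Fintype A] [MeasurableSpace A] [MeasurableSingletonClass A] [DecidableEq A] in
lemma apply_shift_upd (hd : ∀ s, DependsOn (γ s) (Set.Iio 0)) (b : ℤ) (s : A) (x : Conf A) :
    (fun x => γ (x 0) x) (shift b (upd s b x)) = γ s (shift b x) := by
  have h₀ : shift b (upd s b x) 0 = s := by simp [shift, upd]
  change γ (shift b (upd s b x) 0) (shift b (upd s b x)) = γ s (shift b x)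
  rw [h₀]
  refine hd s fun i hi => ?_
  have hi : i < 0 := hi
  have : i + b ≠ b := by omega
  simp [shift, upd, this]

omit [Fintype A] [MeasurableSpace A] [MeasurableSingletonClass A] [DecidableEq A] in
lemma dependsOn_comp_shift (hd : ∀ s, DependsOn (γ s) (Set.Iio 0)) (b : ℤ) (s : A) :
    DependsOn (fun x => γ s (shift b x)) (Set.Iic (b - 1)) := fun x y h => by
  refine hd s fun i hi => h _ ?_
  have hi : i < 0 := hi
  simp only [Set.mem_Iic]
  omega

lemma Specification.HasLimit.integrable_shift [IsFiniteMeasure μ] (hγ : V.HasLimit γ ε) (b : ℤ)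
    (s : A) : Integrable (fun x => γ s (shift b x)) μ := by
  refine integrable_of_abs_le (C := 1) ((hγ.measurable s).comp (measurable_shift b)) fun x => ?_
  rw [abs_of_nonneg (hγ.nonneg _ _)]
  exact hγ.le_one _ _

lemma Specification.HasLimit.isGChain_of_isGibbs [Nonempty A] (hγ : V.HasLimit γ ε)
    (hinv : V.TInvariant) (hd : ∀ s, DependsOn (γ s) (Set.Iio 0)) (h : IsGibbs V μ) :
    IsGChain (fun x => γ (x 0) x) μ := by
  have := h.1
  refine ⟨h.1, fun b s => ?_⟩
  simp only [apply_shift_upd hd, ← site_eq_indicator]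
  refine ae_eq_condExp_of_forall_setIntegral_eq cylSA_le (integrable_site b s)
    (fun B _ _ => (hγ.integrable_shift b s).integrableOn) (fun B hB _ => ?_)
    (measurable_cylSA ((hγ.measurable s).comp (measurable_shift b))
      (dependsOn_comp_shift hd b s)).stronglyMeasurable.aestronglyMeasurable
  have hlim := tendsto_setIntegral_of_abs_sub_le (μ := μ) hγ.rate
    (fun n => integrable_of_abs_le (C := 1) (V.measurable_avg (Finset.Icc b (b + n))
      (measurable_site b s)) fun x => by
        rw [abs_of_nonneg (V.avg_site_nonneg _ _ _ _)]
        exact V.avg_site_le_one _ _ _ _)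
    (hγ.integrable_shift b s) (fun n x => hγ.abs_avg_sub_le hinv b n s x) B
  refine tendsto_nhds_unique (hlim.congr fun n => ?_) tendsto_const_nhds
  have hb : b ∈ Finset.Icc b (b + n) := by simp
  refine (h.2.setIntegral_avg ⟨b, hb⟩ ((site_dependsOn b s).mono (by simp)) ?_).symm
  refine cylSA_mono (fun i hi => ?_) _ hB
  have hi : i ≤ b - 1 := hi
  simp only [Finset.coe_Icc, Set.mem_compl_iff, Set.mem_Icc]
  omega

end GibbsToChain
section ChainToGibbs

lemma eq_sum_upd_mul_site [Fintype A] [DecidableEq A] (F : Conf A → ℝ) (b : ℤ) (y : Conf A) :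
    F y = ∑ s, F (upd s b y) * site b s y := by
  have : upd (y b) b y = y := by
    funext i
    by_cases h : i = b <;> simp [upd, h]
  simp [site, this]

lemma upd_dependsOn {F : Conf A → ℝ} {b : ℤ} (hF : DependsOn F (Set.Iic b)) (s : A) :
    DependsOn (fun x => F (upd s b x)) (Set.Iic (b - 1)) := by
  refine fun x y h => hF fun i hi => ?_
  by_cases hb : i = b
  · simp [upd, hb]
  · have hi : i ≤ b := hi
    simpa [upd, hb] using h i (by simp only [Set.mem_Iic]; omega)

variable [Fintype A] [MeasurableSpace A] [DecidableEq A]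
  {V : Specification A} {γ : A → Conf A → ℝ} {ε : ℕ → ℝ}

lemma Specification.HasLimit.abs_avg_sub_sum_le (hγ : V.HasLimit γ ε) (hinv : V.TInvariant)
    {F : Conf A → ℝ} {C : ℝ} (hC : ∀ x, |F x| ≤ C) {b : ℤ} (hF : DependsOn F (Set.Iic b)) (n : ℕ)
    (x : Conf A) :
    |V.avg (Finset.Icc b (b + n)) F x - ∑ s, F (upd s b x) * γ s (shift b x)| ≤
      Fintype.card A * (C * ε n) := by
  have h₁ : V.avg (Finset.Icc b (b + n)) F x =
      ∑ s, F (upd s b x) * V.avg (Finset.Icc b (b + n)) (site b s) x := by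
    conv_lhs => rw [funext (eq_sum_upd_mul_site F b)]
    rw [V.avg_sum]
    refine Finset.sum_congr rfl fun s _ => V.avg_mul (h := fun y => F (upd s b y)) fun y hy => ?_
    refine upd_dependsOn hF s fun i hi => hy i fun h => ?_
    have hi : i ≤ b - 1 := hi
    have := (Finset.mem_Icc.1 h).1
    omega
  rw [h₁, ← Finset.sum_sub_distrib]
  refine (Finset.abs_sum_le_sum_abs _ _).trans ?_
  refine (Finset.sum_le_card_nsmul _ _ (C * ε n) fun s _ => ?_).trans_eq (by simp)
  rw [← mul_sub, abs_mul]
  exact mul_le_mul (hC _) (hγ.abs_avg_sub_le hinv b n s x) (abs_nonneg _)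
    ((abs_nonneg _).trans (hC x))

variable [MeasurableSingletonClass A] {μ : Measure (Conf A)} [IsProbabilityMeasure μ]

omit [DecidableEq A] [MeasurableSingletonClass A] in
lemma integrable_avg (V : Specification A) (Λ : Finset ℤ) {F : Conf A → ℝ} (hF : Measurable F)
    {C : ℝ} (hC : ∀ x, |F x| ≤ C) : Integrable (V.avg Λ F) μ :=
  integrable_of_abs_le (V.measurable_avg Λ hF) (V.abs_avg_le hC)

lemma Specification.HasLimit.integral_eq_sum (hγ : V.HasLimit γ ε)
    (hc : ∀ b s, (fun x => γ s (shift b x)) =ᵐ[μ] μ[site b s | cylSA (Set.Iic (b - 1))])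
    {F : Conf A → ℝ} (hm : Measurable F) {C : ℝ} (hC : ∀ x, |F x| ≤ C) {b : ℤ}
    (hF : DependsOn F (Set.Iic b)) :
    ∫ x, F x ∂μ = ∫ x, ∑ s, F (upd s b x) * γ s (shift b x) ∂μ := by
  have hu : ∀ s, Measurable fun x => F (upd s b x) := fun s => hm.comp (measurable_upd s b)
  have hsite : ∀ s, Integrable (fun x => F (upd s b x) * site b s x) μ := fun s =>
    (integrable_site b s).bdd_mul (hu s).aestronglyMeasurable
      (Eventually.of_forall fun x => hC (upd s b x))
  have hlim : ∀ s, Integrable (fun x => F (upd s b x) * γ s (shift b x)) μ := fun s =>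
    (hγ.integrable_shift b s).bdd_mul (hu s).aestronglyMeasurable
      (Eventually.of_forall fun x => hC (upd s b x))
  rw [integral_congr_ae (Eventually.of_forall (eq_sum_upd_mul_site F b)), integral_finsetSum _
    fun s _ => hsite s, integral_finsetSum _ fun s _ => hlim s]
  refine Finset.sum_congr rfl fun s _ => ?_
  have hpull := condExp_mul_of_stronglyMeasurable_left
    (measurable_cylSA (hu s) (upd_dependsOn hF s)).stronglyMeasurable (hsite s)
    (integrable_site (μ := μ) b s)
  calc ∫ x, F (upd s b x) * site b s x ∂μ
      = ∫ x, (μ[(fun x => F (upd s b x)) * site b s | cylSA (Set.Iic (b - 1))]) x ∂μ :=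
        (integral_condExp cylSA_le).symm
    _ = ∫ x, F (upd s b x) * γ s (shift b x) ∂μ := by
        refine integral_congr_ae ?_
        filter_upwards [hpull, hc b s] with x h₁ h₂
        rw [h₁, Pi.mul_apply, ← h₂]

lemma Specification.HasLimit.tendsto_integral_avg (hγ : V.HasLimit γ ε) (hinv : V.TInvariant)
    (hd : ∀ s, DependsOn (γ s) (Set.Iio 0))
    (hc : ∀ b s, (fun x => γ s (shift b x)) =ᵐ[μ] μ[site b s | cylSA (Set.Iic (b - 1))])
    (a : ℤ) (k : ℕ) {F : Conf A → ℝ} (hm : Measurable F) {C : ℝ} (hC : ∀ x, |F x| ≤ C)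
    (hF : DependsOn F (Set.Iio (a + k))) :
    Tendsto (fun n : ℕ => ∫ x, V.avg (Finset.Icc a (a + n)) F x ∂μ) atTop
      (nhds (∫ x, F x ∂μ)) := by
  induction k generalizing F C with
  | zero =>
    refine tendsto_const_nhds.congr fun n => integral_congr_ae (Eventually.of_forall fun x => ?_)
    refine (V.avg_of_forall_eq fun y hy => hF fun i hi => hy i fun h => ?_).symm
    have h₁ : i < a + (0 : ℕ) := hi
    have := (Finset.mem_Icc.1 h).1
    omega
  | succ k ih =>
    have hFk : DependsOn F (Set.Iic (a + k)) := hF.mono fun i hi => by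
      have hi : i < a + (k + 1 : ℕ) := hi
      simp only [Set.mem_Iic]
      omega
    set G : Conf A → ℝ := fun x => ∑ s, F (upd s (a + k) x) * γ s (shift (a + k) x) with hG
    have hGm : Measurable G := Finset.measurable_sum _ fun s _ =>
      (hm.comp (measurable_upd s _)).mul ((hγ.measurable s).comp (measurable_shift _))
    have hGC : ∀ x, |G x| ≤ C := fun x => by
      refine (Finset.abs_sum_le_sum_abs _ _).trans ?_
      calc ∑ s, |F (upd s (a + k) x) * γ s (shift (a + k) x)|
          ≤ ∑ s, C * γ s (shift (a + k) x) := Finset.sum_le_sum fun s _ => by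
            rw [abs_mul, abs_of_nonneg (hγ.nonneg _ _)]
            exact mul_le_mul_of_nonneg_right (hC _) (hγ.nonneg _ _)
        _ = C := by rw [← Finset.mul_sum, hγ.sum_eq_one, mul_one]
    have hGd : DependsOn G (Set.Iio (a + k)) := fun x y h => by
      have hsub : ∀ i ∈ Set.Iic (a + k - 1), x i = y i := fun i hi => h i (by
        have hi : i ≤ a + k - 1 := hi
        simp only [Set.mem_Iio]
        omega)
      refine Finset.sum_congr rfl fun s _ => ?_
      have h₁ : F (upd s (a + k) x) = F (upd s (a + k) y) := upd_dependsOn hFk s hsub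
      have h₂ : γ s (shift (a + k) x) = γ s (shift (a + k) y) :=
        dependsOn_comp_shift hd (a + k) s hsub
      rw [h₁, h₂]
    rw [hγ.integral_eq_sum hc hm hC hFk]
    refine (tendsto_add_atTop_iff_nat k).1 ?_
    have hδ : Tendsto (fun n => Fintype.card A * (C * ε n)) atTop (nhds 0) := by
      simpa using (hγ.rate.const_mul C).const_mul (Fintype.card A : ℝ)
    have hIH := (tendsto_add_atTop_iff_nat k).2 (ih hGm hGC hGd)
    refine hIH.congr_dist (squeeze_zero (fun _ => dist_nonneg) (fun n => ?_) hδ)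
    have hsub : Finset.Icc (a + k) (a + k + n) ⊆ Finset.Icc a (a + (n + k : ℕ)) := fun i hi => by
      simp only [Finset.mem_Icc] at hi ⊢
      omega
    have hle : ∀ x, ‖V.avg (Finset.Icc a (a + (n + k : ℕ))) G x -
        V.avg (Finset.Icc a (a + (n + k : ℕ))) F x‖ ≤ Fintype.card A * (C * ε n) := fun x => by
      rw [← V.avg_avg hsub F, ← V.avg_sub]
      refine V.abs_avg_le (fun y => ?_) x
      rw [abs_sub_comm]
      exact hγ.abs_avg_sub_sum_le hinv hC hFk n y
    rw [Real.dist_eq, ← integral_sub (integrable_avg V _ hGm hGC) (integrable_avg V _ hm hC),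
      ← Real.norm_eq_abs]
    simpa using norm_integral_le_of_norm_le_const (μ := μ) (Eventually.of_forall hle)

lemma Specification.HasLimit.tendsto_integral_avg_of_approx (hγ : V.HasLimit γ ε)
    (hinv : V.TInvariant) (hd : ∀ s, DependsOn (γ s) (Set.Iio 0))
    (hc : ∀ b s, (fun x => γ s (shift b x)) =ᵐ[μ] μ[site b s | cylSA (Set.Iic (b - 1))])
    (a : ℤ) {F : Conf A → ℝ} (hm : Measurable F) {C : ℝ} (hC : ∀ x, |F x| ≤ C)
    (happ : ∀ e > 0, ∃ (k : ℕ) (G : Conf A → ℝ), Measurable G ∧ (∀ x, |G x| ≤ C) ∧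
      DependsOn G (Set.Iio (a + k)) ∧ ∀ x, |G x - F x| ≤ e) :
    Tendsto (fun n : ℕ => ∫ x, V.avg (Finset.Icc a (a + n)) F x ∂μ) atTop
      (nhds (∫ x, F x ∂μ)) := by
  rw [Metric.tendsto_atTop]
  intro e he
  obtain ⟨k, G, hGm, hGC, hGd, hGF⟩ := happ (e / 3) (by positivity)
  obtain ⟨N, hN⟩ := Metric.tendsto_atTop.1
    (hγ.tendsto_integral_avg hinv hd hc a k hGm hGC hGd) (e / 3) (by positivity)
  refine ⟨N, fun n hn => ?_⟩
  have h₁ : |∫ x, V.avg (Finset.Icc a (a + n)) G x ∂μ -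
      ∫ x, V.avg (Finset.Icc a (a + n)) F x ∂μ| ≤ e / 3 := by
    rw [← integral_sub (integrable_avg V _ hGm hGC) (integrable_avg V _ hm hC),
      ← Real.norm_eq_abs]
    have hle : ∀ x, ‖V.avg (Finset.Icc a (a + n)) G x - V.avg (Finset.Icc a (a + n)) F x‖ ≤
        e / 3 := fun x => by
      rw [← V.avg_sub]
      exact V.abs_avg_le hGF x
    simpa using norm_integral_le_of_norm_le_const (μ := μ) (Eventually.of_forall hle)
  have h₂ : |∫ x, G x ∂μ - ∫ x, F x ∂μ| ≤ e / 3 := by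
    rw [← integral_sub (integrable_of_abs_le hGm hGC) (integrable_of_abs_le hm hC),
      ← Real.norm_eq_abs]
    have hle : ∀ x, ‖G x - F x‖ ≤ e / 3 := hGF
    simpa using norm_integral_le_of_norm_le_const (μ := μ) (Eventually.of_forall hle)
  have h₃ := hN n hn
  rw [Real.dist_eq] at h₃ ⊢
  rw [abs_le] at h₁ h₂
  rw [abs_lt] at h₃ ⊢
  constructor <;> linarith

end ChainToGibbs

section Truncation

/-- The configuration equal to `x` on `(-∞, b)` and to `w` elsewhere. -/
def trunc (w : Conf A) (b : ℤ) (x : Conf A) : Conf A := fun i => if i < b then x i else w i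

lemma trunc_dependsOn (F : Conf A → ℝ) (w : Conf A) (b : ℤ) :
    DependsOn (fun x => F (trunc w b x)) (Set.Iio b) := fun x y h => by
  have : trunc w b x = trunc w b y := by
    funext i
    by_cases hi : i < b
    · simp [trunc, hi, h i hi]
    · simp [trunc, hi]
  simp only [this]

lemma measurable_trunc [MeasurableSpace A] (w : Conf A) (b : ℤ) : Measurable (trunc w b) := by
  refine measurable_pi_lambda _ fun i => ?_
  by_cases h : i < b
  · simpa [trunc, h] using measurable_pi_apply i
  · simp [trunc, h]

lemma eventually_abs_trunc_sub_le [Finite A] [TopologicalSpace A] {F : Conf A → ℝ}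
    (hF : Continuous F) (w : Conf A) (a : ℤ) {e : ℝ} (he : 0 < e) :
    ∀ᶠ k : ℕ in atTop, ∀ x, |F (trunc w (a + k) x) - F x| ≤ e := by
  have h : TendstoUniformly (fun (k : ℕ) x => F (trunc w (a + k) x)) F atTop := by
    rw [← tendstoLocallyUniformly_iff_tendstoUniformly_of_compactSpace,
      tendstoLocallyUniformly_iff_forall_tendsto]
    intro x
    have htr : Tendsto (fun p : ℕ × Conf A => trunc w (a + p.1) p.2) (atTop ×ˢ nhds x)
        (nhds x) := by
      refine tendsto_pi_nhds.2 fun i => ?_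
      refine (((continuous_apply i).tendsto x).comp tendsto_snd).congr' ?_
      filter_upwards [tendsto_fst.eventually (eventually_gt_atTop (i - a).toNat)] with p hp
      have hi : i < a + p.1 := by omega
      simp [trunc, hi]
    exact (((hF.tendsto x).comp tendsto_snd).prodMk_nhds ((hF.tendsto x).comp htr)).mono_right
      (nhds_le_uniformity (F x))
  filter_upwards [Metric.tendstoUniformly_iff.1 h e he] with k hk x
  have := hk x
  rw [dist_comm, Real.dist_eq] at this
  exact this.le

end Truncation

section CylinderInduction

lemma indicator_one_congr {α : Type*} {E : Set α} {x y : α} (h : x ∈ E ↔ y ∈ E) :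
    E.indicator (fun _ => (1 : ℝ)) x = E.indicator (fun _ => 1) y := by
  by_cases hx : x ∈ E
  · rw [indicator_of_mem hx, indicator_of_mem (h.1 hx)]
  · rw [indicator_of_notMem hx, indicator_of_notMem (mt h.2 hx)]

variable [MeasurableSpace A] {μ : Measure (Conf A)}

lemma setIntegral_eq_of_forall_cylinder {Λ : Set ℤ} {u v : Conf A → ℝ} (hu : Integrable u μ)
    (hv : Integrable v μ)
    (h : ∀ (J : Finset ℤ) (B : Set (Conf A)), (J : Set ℤ) ⊆ Λ → MeasurableSet B →
      DependsOn (B.indicator fun _ => (1 : ℝ)) (J : Set ℤ) → ∫ x in B, u x ∂μ = ∫ x in B, v x ∂μ)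
    {B : Set (Conf A)} (hB : MeasurableSet[cylSA Λ] B) :
    ∫ x in B, u x ∂μ = ∫ x in B, v x ∂μ := by
  have hgen : (cylSA Λ : MeasurableSpace (Conf A)) = MeasurableSpace.generateFrom
      (Set.preimage (fun x : Conf A => Λ.domRestrict x) '' measurableCylinders fun _ : Λ => A) := by
    rw [← MeasurableSpace.comap_generateFrom, generateFrom_measurableCylinders]
    rfl
  have huniv : ∫ x, u x ∂μ = ∫ x, v x ∂μ := by
    simpa using h ∅ univ (by simp) MeasurableSet.univ fun x y _ => by simp
  induction B, hB using MeasurableSpace.induction_on_inter hgen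
    (isPiSystem_measurableCylinders.comap _) with
  | empty => simp
  | basic t ht =>
    obtain ⟨t, ht, rfl⟩ := ht
    obtain ⟨J, D, hD, rfl⟩ := (mem_measurableCylinders _).1 ht
    refine h (J.map (Function.Embedding.subtype _)) _ (by simp) ?_ fun x y hxy => ?_
    · exact (MeasurableSet.cylinder J hD).preimage
        (measurable_pi_lambda _ fun _ => measurable_pi_apply _)
    · have hJ : J.restrict (Λ.domRestrict x) = J.restrict (Λ.domRestrict y) := by
        funext i
        exact hxy _ (by simp)
      have hmem : x ∈ Λ.domRestrict ⁻¹' cylinder J D ↔ y ∈ Λ.domRestrict ⁻¹' cylinder J D := by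
        rw [mem_preimage, mem_preimage, mem_cylinder, mem_cylinder, hJ]
      exact indicator_one_congr hmem
  | compl t ht ih =>
    rw [setIntegral_compl (cylSA_le _ ht) hu, setIntegral_compl (cylSA_le _ ht) hv, ih, huniv]
  | iUnion s hdisj hs ih =>
    rw [integral_iUnion (fun i => cylSA_le _ (hs i)) hdisj hu.integrableOn,
      integral_iUnion (fun i => cylSA_le _ (hs i)) hdisj hv.integrableOn]
    exact tsum_congr ih

end CylinderInduction

section ChainIsGibbs

variable [Fintype A] [Nonempty A] [DecidableEq A] [TopologicalSpace A]
  [MeasurableSpace A] [MeasurableSingletonClass A] {V : Specification A} {γ : A → Conf A → ℝ}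
  {ε : ℕ → ℝ} {μ : Measure (Conf A)}

lemma Specification.HasLimit.setIntegral_cylEvent [IsProbabilityMeasure μ]
    (hγ : V.HasLimit γ ε) (hcont : V.IsCont) (hinv : V.TInvariant)
    (hd : ∀ s, DependsOn (γ s) (Set.Iio 0))
    (hc : ∀ b s, (fun x => γ s (shift b x)) =ᵐ[μ] μ[site b s | cylSA (Set.Iic (b - 1))])
    {Λ : Finset ℤ} (ζ : Λ → A) {J : Finset ℤ} (hJ : (J : Set ℤ) ⊆ (Λ : Set ℤ)ᶜ)
    {B : Set (Conf A)} (hB : MeasurableSet B)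
    (hBJ : DependsOn (B.indicator fun _ => (1 : ℝ)) (J : Set ℤ)) :
    ∫ x in B, (cylEvent Λ ζ).indicator (fun _ => (1 : ℝ)) x ∂μ =
      ∫ x in B, V.φ Λ (ov x Λ ζ) ∂μ := by
  obtain ⟨w⟩ : Nonempty (Conf A) := inferInstance
  obtain ⟨a, ha⟩ : ∃ a : ℤ, ∀ i ∈ Λ, a ≤ i := Λ.bddBelow
  set I : Conf A → ℝ := B.indicator fun _ => 1 with hI
  set Z : Conf A → ℝ := (cylEvent Λ ζ).indicator fun _ => 1 with hZ
  set Ψ : Conf A → ℝ := fun x => V.φ Λ (ov x Λ ζ) with hΨ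
  have hbound : ∀ (E : Set (Conf A)) x, |E.indicator (fun _ => (1 : ℝ)) x| ≤ 1 := fun E x => by
    by_cases hx : x ∈ E <;> simp [hx]
  have hΨle : ∀ x, |Ψ x| ≤ 1 := fun x => by
    rw [abs_of_nonneg (V.nonneg _ _)]
    exact V.phi_le_one _ _
  have hΨm : Measurable Ψ := (V.measurable Λ).comp (measurable_ov Λ ζ)
  have hIm : Measurable I := measurable_const.indicator hB
  have hZm : Measurable Z := measurable_const.indicator (measurableSet_cylEvent Λ ζ)
  have hmul : ∀ {r : ℝ} (x : Conf A), |r| ≤ 1 → |I x * r| ≤ 1 := fun x hr => by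
    rw [abs_mul]
    exact mul_le_one₀ (hbound B x) (abs_nonneg _) hr
  have hset : ∀ F : Conf A → ℝ, ∫ x in B, F x ∂μ = ∫ x, I x * F x ∂μ := fun F => by
    rw [← integral_indicator hB]
    refine integral_congr_ae (Eventually.of_forall fun x => ?_)
    by_cases hx : x ∈ B <;> simp [hI, hx]
  rw [hset, hset]
  have hlt : ∀ J : Finset ℤ, ∀ᶠ k : ℕ in atTop, (J : Set ℤ) ⊆ Set.Iio (a + k) := fun J => by
    refine ((eventually_all_finset J).2 fun i _ => ?_ :
      ∀ᶠ k : ℕ in atTop, ∀ i ∈ J, i < a + k)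
    filter_upwards [eventually_gt_atTop (i - a).toNat] with k hk
    omega
  have h₁ := hγ.tendsto_integral_avg_of_approx (F := fun x => I x * Z x) hinv hd hc a (hIm.mul hZm)
    (fun x => hmul x (hbound _ x)) fun e he => by
      obtain ⟨k, hkJ, hkΛ⟩ := ((hlt J).and (hlt Λ)).exists
      refine ⟨k, fun x => I x * Z x, hIm.mul hZm, fun x => hmul x (hbound _ x), ?_,
        fun x => by simpa using he.le⟩
      intro x y hxy
      have hIxy : I x = I y := hBJ fun i hi => hxy i (hkJ hi)
      have hmem : x ∈ cylEvent Λ ζ ↔ y ∈ cylEvent Λ ζ :=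
        forall_congr' fun i => by rw [hxy i (hkΛ i.2)]
      have hZxy : Z x = Z y := indicator_one_congr hmem
      simp only [hIxy, hZxy]
  have h₂ := hγ.tendsto_integral_avg_of_approx (F := fun x => I x * Ψ x) hinv hd hc a (hIm.mul hΨm)
    (fun x => hmul x (hΨle x)) fun e he => by
      obtain ⟨k, hkJ, hk⟩ := ((hlt J).and (eventually_abs_trunc_sub_le
        ((hcont Λ).comp (continuous_ov Λ ζ)) w a he)).exists
      refine ⟨k, fun x => I x * Ψ (trunc w (a + k) x), hIm.mul (hΨm.comp (measurable_trunc w _)),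
        fun x => hmul x (hΨle _), ?_, fun x => ?_⟩
      · intro x y hxy
        have hIxy : I x = I y := hBJ fun i hi => hxy i (hkJ hi)
        have hΨxy : Ψ (trunc w (a + k) x) = Ψ (trunc w (a + k) y) :=
          trunc_dependsOn Ψ w (a + k) hxy
        simp only [hIxy, hΨxy]
      · change |I x * _ - I x * _| ≤ e
        rw [← mul_sub, abs_mul]
        exact (mul_le_of_le_one_left (abs_nonneg _) (hbound B x)).trans (hk x)
  refine tendsto_nhds_unique (h₁.congr' ?_) h₂
  filter_upwards [hlt Λ] with n hn
  have hsub : Λ ⊆ Finset.Icc a (a + n) := fun i hi => by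
    have : i < a + n := hn hi
    exact Finset.mem_Icc.2 ⟨ha i hi, this.le⟩
  have havg : V.avg Λ (fun x => I x * Z x) = fun x => I x * Ψ x := by
    funext x
    have hIx : I (ov x Λ ζ) = I x := hBJ fun i hi => by
      have : i ∉ Λ := hJ hi
      simp [ov, this]
    rw [V.avg_mul_cylEvent, hIx]
  refine integral_congr_ae (Eventually.of_forall fun x => ?_)
  exact (V.avg_avg hsub _ x).symm.trans (congrArg (fun F => V.avg _ F x) havg)

lemma Specification.HasLimit.isGibbs_of_isGChain (hγ : V.HasLimit γ ε) (hcont : V.IsCont)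
    (hinv : V.TInvariant) (hd : ∀ s, DependsOn (γ s) (Set.Iio 0))
    (h : IsGChain (fun x => γ (x 0) x) μ) : IsGibbs V μ := by
  have := h.1
  have hc := h.2
  simp only [apply_shift_upd hd, ← site_eq_indicator] at hc
  refine ⟨h.1, fun Λ _ ζ => ?_⟩
  have hm : Measurable fun x => V.φ Λ (ov x Λ ζ) := (V.measurable Λ).comp (measurable_ov Λ ζ)
  have hΨ : Integrable (fun x => V.φ Λ (ov x Λ ζ)) μ := integrable_of_abs_le (C := 1) hm fun x => by
    rw [abs_of_nonneg (V.nonneg _ _)]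
    exact V.phi_le_one _ _
  have hZ : Integrable ((cylEvent Λ ζ).indicator fun _ => (1 : ℝ)) μ :=
    (integrable_const 1).indicator (measurableSet_cylEvent Λ ζ)
  refine ae_eq_condExp_of_forall_setIntegral_eq cylSA_le hZ (fun B _ _ => hΨ.integrableOn)
    (fun B hB _ => ?_)
    (measurable_cylSA hm (phi_ov_dependsOn Λ ζ)).stronglyMeasurable.aestronglyMeasurable
  exact setIntegral_eq_of_forall_cylinder hΨ hZ (fun J B hJ hB hBJ =>
    (hγ.setIntegral_cylEvent hcont hinv hd hc ζ hJ hB hBJ).symm) hB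

end ChainIsGibbs

end

/-- **Theorem 4.2.**  If `∑_k ∏_{j=0}^k inf_i r̄_{(-∞,i+j]}(f_i) = ∞`, then
`g_𝒱 = lim_n π^𝒱_{[0,n]}([x]_{{0}} | x)` exists uniformly, is a strictly positive
continuous member of `𝒢_X` with `r_{[-n,0]}(g_𝒱) ≤ (1 + R_n⁻¹)²`, and the Gibbs
states of `𝒱` are exactly the `g_𝒱`-chains. -/
theorem gibbs_iff_gchain_of_divergence
    {S : Type} [Fintype S] [Nonempty S] [DecidableEq S]
    [TopologicalSpace S] [DiscreteTopology S]
    [MeasurableSpace S] [MeasurableSingletonClass S]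
    (V : Specification S) (hpos : V.Positive) (hcont : V.IsCont)
    (hinv : V.TInvariant) (f : ℕ → Conf S → ℝ) (hseq : IsSpecSeqFor V f)
    (hdiv : Tendsto
      (fun N : ℕ => ∑ k ∈ Finset.range (N + 1), ∏ j ∈ Finset.range (k + 1),
        ⨅ i : ℕ, rInf (Set.Iic ((i : ℤ) + (j : ℤ))) (f i))
      atTop atTop) :
    ∃ g : Conf S → ℝ,
      TendstoUniformly (fun n : ℕ => fun x : Conf S => piG V n x) g atTop ∧
      Continuous g ∧ (∀ x, 0 < g x) ∧ MemG g ∧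
      (∀ n : ℕ,
        ENNReal.ofReal (rSup (Set.Icc (-(n : ℤ)) 0) g) ≤
          (1 + (∑' k : ℕ, ENNReal.ofReal (∏ j ∈ Finset.range (k + 1),
              ⨅ i : ℕ, rInf (Set.Icc (-(n : ℤ)) ((i : ℤ) + (j : ℤ))) (f i)))⁻¹) ^ 2) ∧
      ∀ μ : Measure (Conf S), IsGibbs V μ ↔ IsGChain g μ := by
  obtain ⟨γ, hγ⟩ := V.exists_hasLimit hseq hdiv
  have hd : ∀ s, DependsOn (γ s) (Set.Iio 0) := fun s => hγ.dependsOn hseq hdiv s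
  have hγpos : ∀ s x, 0 < γ s x := hγ.pos hpos hseq hdiv
  refine ⟨fun x => γ (x 0) x, hγ.tendstoUniformly, ?_, fun x => hγpos _ x, hγ.memG hd,
    hγ.rSup_le hγpos hseq, fun μ => ⟨hγ.isGChain_of_isGibbs hinv hd,
      hγ.isGibbs_of_isGChain hcont hinv hd⟩⟩
  simp only [apply_symbol_eq_sum γ]
  exact continuous_finsetSum _ fun s _ => (continuous_site 0 s).mul (hγ.continuous hcont s)

end GibbsFormal
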